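/- arXiv:0812.2739 — 2 statements merged into one kernel-verified Lean document; each statement's English description precedes it below -/
import Mathlib

section
/- Let k be an algebraically closed field, s ≥ 1, and n₁,…,nₛ positive integers; set P := ℙ^{n₁} × ⋯ × ℙ^{nₛ} over k. Let f : X → P be a morphism of schemes over k, where X is a complete irreducible variety, and for each i = 1,…,s let L_i ⊆ ℙ^{n_i} be a linear subspace of codimension ≥ 1. If dim p_J(f(X)) ≥ Σ_{i∈J} codim_{ℙ^{n_i}}(L_i) for every nonempty subset J ⊆ {1,…,s}, then f⁻¹(L₁ × ⋯ × Lₛ) is nonempty. -/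
/-!
Part (1) of Debarre's theorem (Theorem 2.8): if `f : X → P = ℙ^{n₁} × ⋯ × ℙ^{nₛ}` is a
morphism from a complete irreducible variety and `L_i ⊆ ℙ^{n_i}` are linear subspaces of
codimension `r_i ≥ 1` with `dim p_J(f(X)) ≥ ∑_{i ∈ J} r_i` for every nonempty `J`, then
`f⁻¹(L₁ × ⋯ × Lₛ)` is nonempty.

A linear subspace of `ℙⁿ` is encoded as the common zero locus `L` of a set `T` of linear
forms (degree-one homogeneous polynomials); its codimension `r` is pinned down by
`dim L = n - r` with `1 ≤ r ≤ n`.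
-/

open AlgebraicGeometry CategoryTheory CategoryTheory.Limits MvPolynomial

attribute [local instance] MvPolynomial.gradedAlgebra

noncomputable section

/-- Projective `n`-space over `k`, as the `Proj` of the standard graded polynomial ring
`k[x₀, …, xₙ]`. -/
def ProjSpace (k : Type) [Field k] (n : ℕ) : Scheme :=
  Proj (homogeneousSubmodule (Fin (n + 1)) k)

/-- The structure morphism `ℙⁿ_k ⟶ Spec k`. -/
def ProjSpace.structMap (k : Type) [Field k] (n : ℕ) : ProjSpace k n ⟶ Spec (.of k) :=
  Proj.toSpecZero _ ≫ Spec.map (CommRingCat.ofHom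
    (algebraMap k (homogeneousSubmodule (Fin (n + 1)) k 0)))

/-- `ℙⁿ_k` as a scheme over `Spec k`. -/
abbrev ProjOver (k : Type) [Field k] (n : ℕ) : Over (Spec (CommRingCat.of k)) :=
  Over.mk (ProjSpace.structMap k n)

/-- The product `P = ℙ^{n 0} ×_k ⋯ ×_k ℙ^{n (s-1)}` of projective spaces over `k`. -/
abbrev Pprod (k : Type) [Field k] (s : ℕ) (n : Fin s → ℕ) : Over (Spec (CommRingCat.of k)) :=
  ∏ᶜ fun i : Fin s => ProjOver k (n i)

/-- The partial product `P_J = ∏_{i ∈ J} ℙ^{n i}` over `k`. -/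
abbrev PprodJ (k : Type) [Field k] (s : ℕ) (n : Fin s → ℕ) (J : Finset (Fin s)) :
    Over (Spec (CommRingCat.of k)) :=
  ∏ᶜ fun i : J => ProjOver k (n i)

/-- The canonical projection `p_J : P ⟶ P_J`. -/
def projJ (k : Type) [Field k] (s : ℕ) (n : Fin s → ℕ) (J : Finset (Fin s)) :
    Pprod k s n ⟶ PprodJ k s n J :=
  Pi.lift fun i : J => Pi.π (fun i : Fin s => ProjOver k (n i)) i

/-- The linear subspace of `ℙⁿ` cut out (set-theoretically) by a set `T` of linear forms. -/
def linSub (k : Type) [Field k] (n : ℕ) (T : Set (MvPolynomial (Fin (n + 1)) k)) :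
    Set (ProjSpace k n) :=
  {x : ProjSpace k n | ∀ σ ∈ T, σ ∈ x.asHomogeneousIdeal}

section Generic

open AlgebraicIndependent

variable {k K : Type*} [Field k] [Field K] [Algebra k K] {A : Type*}
  {τ : A → Type*} [∀ a, Fintype (τ a)]

/-- The linear combination of the family `y a` with generic coefficients. -/
def genericForm (y : ∀ a, τ a → K) (a : A) : MvPolynomial (Σ a, τ a) K :=
  ∑ j, X ⟨a, j⟩ * C (y a j)

/-- The translation of the polynomial ring adding one to the variable `p`. -/
def shiftVar {σ : Type*} [DecidableEq σ] (p : σ) : MvPolynomial σ K →ₐ[K] MvPolynomial σ K :=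
  aeval fun q => X q + if q = p then 1 else 0

lemma shiftVar_genericForm_self [DecidableEq (Σ a, τ a)] (y : ∀ a, τ a → K) (a : A) (j : τ a) :
    shiftVar (⟨a, j⟩ : Σ a, τ a) (genericForm y a) = genericForm y a + C (y a j) := by
  classical
  simp only [genericForm, shiftVar, map_sum, map_mul, aeval_X, add_mul, Finset.sum_add_distrib,
    algHom_C, algebraMap_eq]
  congr 1
  rw [Finset.sum_eq_single j] <;> simp +contextual

lemma shiftVar_genericForm_of_ne [DecidableEq (Σ a, τ a)] (y : ∀ a, τ a → K) {a b : A}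
    (h : b ≠ a) (j : τ a) :
    shiftVar (⟨a, j⟩ : Σ a, τ a) (genericForm y b) = genericForm y b := by
  simp only [genericForm, shiftVar, map_sum, map_mul, aeval_X, add_mul, Finset.sum_add_distrib,
    algHom_C, algebraMap_eq]
  simp [h]

lemma shiftVar_injective {σ : Type*} [DecidableEq σ] (p : σ) :
    Function.Injective (shiftVar (K := K) p) := by
  have : Function.LeftInverse
      (aeval (R := K) (fun q : σ => (X q : MvPolynomial σ K) - if q = p then 1 else 0))
      (shiftVar (K := K) p) := by
    intro x
    rw [← AlgHom.comp_apply]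
    conv_rhs => rw [← AlgHom.id_apply (R := K) x]
    congr 1
    ext q
    simp only [shiftVar, AlgHom.comp_apply, aeval_X, map_add, AlgHom.id_apply]
    split_ifs <;> simp
  exact this.injective

/-- Generic linear combinations of families satisfying Rado's condition are algebraically
independent, also together with their generic coefficients. -/
theorem algebraicIndependent_genericForm [Finite A] (y : ∀ a, τ a → K)
    (h : ∀ S : Finset A, S.Nonempty →
      (S.card : ℕ∞) ≤ (matroid k K).eRk {z | ∃ a ∈ S, ∃ j, y a j = z}) :
    AlgebraicIndependent k (Sum.elim (X : (Σ a, τ a) → MvPolynomial (Σ a, τ a) K)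
      (genericForm y)) := by
  classical
  set u := Sum.elim (X : (Σ a, τ a) → MvPolynomial (Σ a, τ a) K) (genericForm y)
  let s : Finset A → Set ((Σ a, τ a) ⊕ A) := fun S => Set.range Sum.inl ∪ Sum.inr '' (S : Set A)
  suffices H : ∀ S : Finset A, AlgebraicIndepOn k u (s S) by
    cases nonempty_fintype A
    have := H Finset.univ
    have hs : s Finset.univ = Set.univ := by
      simp [s, Set.range_inl_union_range_inr]
    rw [hs] at this
    exact AlgebraicIndepOn.univ.mp this
  intro S
  induction S using Finset.strongInduction with
  | H S ih =>
  rcases S.eq_empty_or_nonempty with rfl | hS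
  · have : s ∅ = Set.range Sum.inl := by simp [s]
    rw [this, AlgebraicIndepOn, ← algebraicIndependent_equiv
      (Equiv.ofInjective _ (Sum.inl_injective (α := (Σ a, τ a)) (β := A)))]
    exact (algebraicIndependent_X (Σ a, τ a) K).restrictScalars
      (FaithfulSMul.algebraMap_injective k K)
  by_contra hdep
  have hins : ∀ a ∈ S, s S = insert (Sum.inr a) (s (S.erase a)) := by
    intro a ha
    ext (p | b)
    · simp [s]
    · by_cases hb : b = a <;> simp [s, hb, ha]
  have halg : ∀ a ∈ S, IsAlgebraic (Algebra.adjoin k (u '' s (S.erase a))) (genericForm y a) := by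
    intro a ha
    by_contra htr
    apply hdep
    rw [hins a ha]
    exact (ih _ (Finset.erase_ssubset ha)).insert htr
  have hcl : ∀ a ∈ S, ∀ j, C (y a j) ∈ (matroid k (MvPolynomial (Σ a, τ a) K)).closure
      (u '' s (S.erase a)) := by
    intro a ha j
    rw [matroid_closure_eq]
    change IsAlgebraic _ _
    let σ : MvPolynomial (Σ a, τ a) K →ₐ[k] MvPolynomial (Σ a, τ a) K :=
      (shiftVar (⟨a, j⟩ : Σ a, τ a)).restrictScalars k
    have hσ : ∀ x ∈ Algebra.adjoin k (u '' s (S.erase a)),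
        σ x ∈ Algebra.adjoin k (u '' s (S.erase a)) := by
      suffices Algebra.adjoin k (u '' s (S.erase a)) ≤
        (Algebra.adjoin k (u '' s (S.erase a))).comap σ from this
      rw [Algebra.adjoin_le_iff]
      rintro _ ⟨i, hi, rfl⟩
      rcases i with p | b
      · change shiftVar (⟨a, j⟩ : Σ a, τ a) (X p) ∈ Algebra.adjoin k (u '' s (S.erase a))
        rw [shiftVar, aeval_X]
        refine add_mem (Algebra.subset_adjoin ⟨_, hi, rfl⟩) ?_
        split_ifs
        exacts [one_mem _, zero_mem _]
      · change shiftVar (⟨a, j⟩ : Σ a, τ a) (genericForm y b) ∈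
          Algebra.adjoin k (u '' s (S.erase a))
        rw [shiftVar_genericForm_of_ne]
        · exact Algebra.subset_adjoin ⟨_, hi, rfl⟩
        · rintro rfl
          simp [s] at hi
    have h1 := halg a ha
    have h2 : IsAlgebraic (Algebra.adjoin k (u '' s (S.erase a))) (σ (genericForm y a)) := by
      refine h1.ringHom_of_comp_eq
        (((σ.comp (Algebra.adjoin k (u '' s (S.erase a))).val).codRestrict _
          fun x => hσ _ x.2).toRingHom) σ.toRingHom ?_ ?_
      · intro x z hxz
        exact Subtype.ext (shiftVar_injective _ (congrArg Subtype.val hxz))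
      · ext x; rfl
    have h3 : σ (genericForm y a) = genericForm y a + C (y a j) := shiftVar_genericForm_self y a j
    rw [h3] at h2
    simpa using h2.sub h1
  set M := matroid k (MvPolynomial (Σ a, τ a) K)
  obtain ⟨I, hI⟩ := (matroid k K).exists_isBasis {z | ∃ a ∈ S, ∃ j, y a j = z}
  have hcard := h S hS
  rw [← hI.encard_eq_eRk] at hcard
  have hind : AlgebraicIndependent k (Sum.elim (X : (Σ a, τ a) → MvPolynomial (Σ a, τ a) K)
      (algebraMap K _ ∘ ((↑) : I → K))) :=
    AlgebraicIndependent.sumElim_comp (matroid_indep_iff.mp hI.indep) (algebraicIndependent_X _ K)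
  have hind' : M.Indep (Set.range X ∪ C '' I) := by
    have := hind.to_subtype_range
    rw [Set.Sum.elim_range, Set.range_comp, Subtype.range_coe] at this
    exact matroid_indep_iff.mpr this
  obtain ⟨a₀, ha₀⟩ := hS
  have hsub : Set.range X ∪ C '' I ⊆ M.closure (u '' s S) := by
    rintro _ (⟨p, rfl⟩ | ⟨z, hz, rfl⟩)
    · exact M.mem_closure_of_mem' ⟨Sum.inl p, by simp [s], rfl⟩
    · obtain ⟨a, ha, j, rfl⟩ := hI.subset hz
      refine M.closure_subset_closure ?_ (hcl a ha j)
      rw [hins a ha]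
      exact Set.image_mono (Set.subset_insert _ _)
  have hrk : M.eRk (u '' s S) ≤ (u '' s (S.erase a₀)).encard := by
    refine le_trans ?_ (M.eRk_le_encard _)
    rw [← M.eRk_closure_eq (u '' s (S.erase a₀))]
    refine M.eRk_mono ?_
    rw [hins a₀ ha₀, Set.image_insert_eq, Set.insert_subset_iff]
    refine ⟨?_, M.subset_closure _⟩
    rw [matroid_closure_eq]
    change IsAlgebraic _ _
    exact halg a₀ ha₀
  have hle : (Set.range (X : (Σ a, τ a) → MvPolynomial (Σ a, τ a) K) ∪ C '' I).encard ≤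
      (u '' s (S.erase a₀)).encard := by
    refine le_trans ?_ hrk
    rw [← hind'.eRk_eq_encard, ← M.eRk_closure_eq (u '' s S)]
    exact M.eRk_mono hsub
  have e1 : (Set.range (X : (Σ a, τ a) → MvPolynomial (Σ a, τ a) K) ∪ C '' I).encard =
      ENat.card (Σ a, τ a) + I.encard := by
    rw [Set.encard_union_eq, (C_injective _ _).encard_image, ← Set.image_univ,
      (X_injective).encard_image, Set.encard_univ]
    rw [Set.disjoint_left]
    rintro _ ⟨p, rfl⟩ ⟨z, -, hz⟩
    simpa using congrArg totalDegree hz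
  have e2 : (u '' s (S.erase a₀)).encard ≤ ENat.card (Σ a, τ a) + (S.erase a₀).card := by
    refine (Set.encard_image_le _ _).trans ((Set.encard_union_le _ _).trans ?_)
    rw [← Set.image_univ, Sum.inl_injective.encard_image, Set.encard_univ,
      Sum.inr_injective.encard_image, Set.encard_coe_eq_coe_finsetCard]
  have e3 := (e1 ▸ hle).trans e2
  have hfin : ENat.card (Σ a, τ a) ≠ ⊤ := by
    cases nonempty_fintype A
    simp
  have e4 := hcard.trans ((ENat.add_le_add_iff_left hfin).mp e3)
  have := Finset.card_erase_lt_of_mem ha₀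
  exact absurd (Nat.cast_le.mp e4) (by omega)

end Generic

namespace ProjSpace

section Coordinates

open HomogeneousLocalization

variable {k : Type} [Field k] {n : ℕ} {R : Type} [CommRing R] [Algebra k R]

local notation "𝒜" => homogeneousSubmodule (Fin (n + 1)) k

lemma X_mem_one (c : Fin (n + 1)) : (X c : MvPolynomial (Fin (n + 1)) k) ∈ 𝒜 1 :=
  isHomogeneous_X k c

/-- The function `x_j / x_c` on the standard chart `x_c ≠ 0`. -/
def ratio (c j : Fin (n + 1)) : Away 𝒜 (X c) :=
  Away.mk 𝒜 (X_mem_one c) 1 (X j) (X_mem_one j)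

/-- The scalar homomorphism into the coordinate ring of a standard chart. -/
def chartScalar (c : Fin (n + 1)) : k →+* Away 𝒜 (X c) :=
  (fromZeroRingHom 𝒜 (Submonoid.powers (X c))).comp (algebraMap k (𝒜 0))

lemma val_chartScalar (c : Fin (n + 1)) (a : k) :
    (chartScalar c a).val = algebraMap (MvPolynomial (Fin (n + 1)) k)
      (Localization.Away (X c : MvPolynomial (Fin (n + 1)) k)) (C a) := rfl

lemma smul_eval₂ {A B : Type*} [CommRing A] [CommRing B] {τ : Type*} [Fintype τ] {m : ℕ}
    {p : MvPolynomial τ A} (hp : p.IsHomogeneous m) (g : A →+* B) (y : τ → B) (u : B) :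
    eval₂ g (fun j => u * y j) p = u ^ m * eval₂ g y p := by
  rw [eval₂_eq', eval₂_eq', Finset.mul_sum]
  refine Finset.sum_congr rfl fun d hd => ?_
  have h := hp (mem_support_iff.mp hd)
  rw [Finsupp.weight_apply, Finsupp.sum_fintype _ _ (by simp)] at h
  simp only [Pi.one_apply, smul_eq_mul, mul_one] at h
  rw [← h]
  simp only [mul_pow, Finset.prod_mul_distrib, Finset.prod_pow_eq_pow_sum]
  ring

lemma away_mk_eq_eval₂ (c : Fin (n + 1)) (m : ℕ) (p : MvPolynomial (Fin (n + 1)) k)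
    (hp : p ∈ 𝒜 (m • 1)) :
    Away.mk 𝒜 (X_mem_one c) m p hp = eval₂ (chartScalar c) (ratio c) p := by
  let P := MvPolynomial (Fin (n + 1)) k
  let L := Localization.Away (X c : P)
  have hu : ∀ j, algebraMap P L (X c) * (ratio c j).val = algebraMap P L (X j) := by
    intro j
    rw [ratio, Away.val_mk, Localization.mk_eq_mk']
    have h := IsLocalization.mk'_spec' L (X j : P)
      (⟨X c ^ 1, 1, rfl⟩ : Submonoid.powers (X c : P))
    rwa [show ((⟨X c ^ 1, 1, rfl⟩ : Submonoid.powers (X c : P)) : P) = X c from pow_one _] at h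
  apply val_injective
  rw [← HomogeneousLocalization.algebraMap_apply, ← HomogeneousLocalization.algebraMap_apply,
    MvPolynomial.hom_eval₂, HomogeneousLocalization.algebraMap_apply, Away.val_mk,
    Localization.mk_eq_mk', IsLocalization.mk'_eq_iff_eq_mul]
  have h := smul_eval₂ (m := m) (by simpa using hp)
    ((algebraMap (Away 𝒜 (X c : P)) L).comp (chartScalar c))
    (fun j => (ratio c j).val) (algebraMap P L (X c))
  simp only [hu] at h
  rw [map_pow, mul_comm]
  refine Eq.trans ?_ h
  have h2 : (algebraMap (Away 𝒜 (X c : P)) L).comp (chartScalar c) = (algebraMap P L).comp C :=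
    RingHom.ext fun a => val_chartScalar c a
  rw [h2, ← MvPolynomial.hom_eval₂, eval₂_eta]

/-- A ring homomorphism out of a standard chart evaluates forms at its coordinates. -/
lemma hom_away_mk (c : Fin (n + 1)) (h : Away 𝒜 (X c) →+* R)
    (hk : h.comp (chartScalar c) = algebraMap k R) (m : ℕ) (p : MvPolynomial (Fin (n + 1)) k)
    (hp : p ∈ 𝒜 (m • 1)) :
    h (Away.mk 𝒜 (X_mem_one c) m p hp) = aeval (fun j => h (ratio c j)) p := by
  rw [away_mk_eq_eval₂, hom_eval₂, hk]
  rfl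

/-- Evaluation at a point of the chart `x_c = 1`. -/
def evalAway (c : Fin (n + 1)) (y : Fin (n + 1) → R) (hy : y c = 1) : Away 𝒜 (X c) →+* R :=
  (Localization.awayLift (aeval y : MvPolynomial (Fin (n + 1)) k →ₐ[k] R).toRingHom (X c)
    (by simp [hy])).comp (algebraMap (Away 𝒜 (X c)) (Localization.Away (X c)))

lemma evalAway_mk (c : Fin (n + 1)) (y : Fin (n + 1) → R) (hy : y c = 1) (m : ℕ)
    (p : MvPolynomial (Fin (n + 1)) k) (hp : p ∈ 𝒜 (m • 1)) :
    evalAway c y hy (Away.mk 𝒜 (X_mem_one c) m p hp) = aeval y p := by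
  rw [evalAway, RingHom.comp_apply, HomogeneousLocalization.algebraMap_apply, Away.val_mk]
  refine (Localization.awayLift_mk _ _ _ 1 (by simp [hy]) _).trans (by simp)

lemma evalAway_ratio (c : Fin (n + 1)) (y : Fin (n + 1) → R) (hy : y c = 1) (j : Fin (n + 1)) :
    evalAway (k := k) c y hy (ratio c j) = y j := by
  rw [ratio, evalAway_mk, aeval_X]

lemma evalAway_comp_chartScalar (c : Fin (n + 1)) (y : Fin (n + 1) → R) (hy : y c = 1) :
    (evalAway c y hy).comp (chartScalar c) = algebraMap k R := by
  ext a
  have hC : (C a : MvPolynomial (Fin (n + 1)) k) ∈ 𝒜 (0 • 1) := by simp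
  have : chartScalar c a = Away.mk 𝒜 (X_mem_one c) 0 (C a) hC := by
    apply val_injective
    rw [Away.val_mk, val_chartScalar, Localization.mk_eq_mk',
      ← IsLocalization.mk'_one (M := .powers (X c))]
    congr 1
  rw [RingHom.comp_apply, this, evalAway_mk, aeval_C]

lemma eq_evalAway (c : Fin (n + 1)) (h : Away 𝒜 (X c) →+* R)
    (hk : h.comp (chartScalar c) = algebraMap k R) (y : Fin (n + 1) → R) (hy : y c = 1)
    (hyh : ∀ j, h (ratio c j) = y j) : h = evalAway c y hy := by
  ext x
  obtain ⟨m, p, hp, rfl⟩ := Away.mk_surjective 𝒜 (X_mem_one c) x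
  rw [hom_away_mk c h hk, evalAway_mk]
  simp [hyh]

lemma ratio_self (c : Fin (n + 1)) : ratio (k := k) c c = 1 := by
  rw [ratio]
  apply val_injective
  simp

/-- The open immersion of the standard chart `x_c ≠ 0`. -/
def chart (k : Type) [Field k] {n : ℕ} (c : Fin (n + 1)) :
    Spec (.of (Away (homogeneousSubmodule (Fin (n + 1)) k) (X c))) ⟶ ProjSpace k n :=
  Proj.awayι _ (X c) (X_mem_one c) one_pos

instance (c : Fin (n + 1)) : IsOpenImmersion (chart k c) :=
  inferInstanceAs (IsOpenImmersion (Proj.awayι _ _ _ _))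

lemma chart_structMap (c : Fin (n + 1)) :
    chart k c ≫ structMap k n = Spec.map (CommRingCat.ofHom (chartScalar c)) := by
  rw [chart, structMap, chartScalar, CommRingCat.ofHom_comp, Spec.map_comp,
    ← Proj.awayι_toSpecZero _ _ (X_mem_one c) one_pos]
  exact (Category.assoc _ _ _).symm

/-- The morphism to projective space with homogeneous coordinates `y`, where `y c = 1`. -/
def ofCoords (k : Type) [Field k] {n : ℕ} {R : Type} [CommRing R] [Algebra k R]
    (c : Fin (n + 1)) (y : Fin (n + 1) → R) (hy : y c = 1) :
    Spec (.of R) ⟶ ProjSpace k n :=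
  Spec.map (CommRingCat.ofHom (evalAway c y hy)) ≫ chart k c

lemma ofCoords_structMap (c : Fin (n + 1)) (y : Fin (n + 1) → R) (hy : y c = 1) :
    ofCoords k c y hy ≫ structMap k n = Spec.map (CommRingCat.ofHom (algebraMap k R)) := by
  rw [ofCoords, Category.assoc, chart_structMap, ← Spec.map_comp, ← CommRingCat.ofHom_comp,
    evalAway_comp_chartScalar]

lemma specMap_ofCoords {S : Type} [CommRing S] [Algebra k S] (g : R →ₐ[k] S)
    (c : Fin (n + 1)) (y : Fin (n + 1) → R) (hy : y c = 1) :
    Spec.map (CommRingCat.ofHom (g : R →+* S)) ≫ ofCoords k c y hy =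
      ofCoords k c (fun j => g (y j)) (by simp [hy]) := by
  rw [ofCoords, ofCoords, ← Category.assoc, ← Spec.map_comp, ← CommRingCat.ofHom_comp]
  congr 3
  apply eq_evalAway
  · rw [RingHom.comp_assoc, evalAway_comp_chartScalar]
    exact g.comp_algebraMap
  · intro j
    rw [RingHom.comp_apply, evalAway_ratio]
    rfl

/-- A linear form vanishes at the image of a point if and only if its value at the coordinates
lies in the corresponding prime. -/
lemma mem_ofCoords_iff (c : Fin (n + 1)) (y : Fin (n + 1) → R) (hy : y c = 1)
    (z : Spec (.of R)) (σ : MvPolynomial (Fin (n + 1)) k) (hσ : σ.IsHomogeneous 1) :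
    σ ∈ ProjectiveSpectrum.asHomogeneousIdeal (ofCoords k c y hy z) ↔ aeval y σ ∈ z.asIdeal := by
  have h := Proj.awayι_preimage_basicOpen 𝒜 (X_mem_one c) one_pos
    ((mem_homogeneousSubmodule 1 σ).mpr hσ) one_pos
  rw [← not_iff_not]
  have h1 : σ ∉ ProjectiveSpectrum.asHomogeneousIdeal (ofCoords k c y hy z) ↔
      Spec.map (CommRingCat.ofHom (evalAway c y hy)) z ∈
        Proj.awayι 𝒜 (X c) (X_mem_one c) one_pos ⁻¹ᵁ Proj.basicOpen 𝒜 σ := by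
    rw [ofCoords, Scheme.Hom.comp_apply]
    exact (Proj.mem_basicOpen _ _ _).symm
  rw [h1, h]
  refine not_congr (a := Away.isLocalizationElem (X_mem_one c) hσ ∈
    (Spec.map (CommRingCat.ofHom (evalAway c y hy)) z).asIdeal) ?_
  change evalAway c y hy (Away.mk 𝒜 (X_mem_one c) 1 (σ ^ 1) _) ∈ z.asIdeal ↔ _
  rw [evalAway_mk, pow_one]

/-- A morphism over `k` from a local scheme to projective space has homogeneous coordinates. -/
lemma exists_ofCoords [IsLocalRing R] (φ : Spec (.of R) ⟶ ProjSpace k n)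
    (hφ : φ ≫ structMap k n = Spec.map (CommRingCat.ofHom (algebraMap k R))) :
    ∃ (c : Fin (n + 1)) (y : Fin (n + 1) → R) (hy : y c = 1), φ = ofCoords k c y hy := by
  have hcov : ⨆ c : Fin (n + 1), Proj.basicOpen 𝒜 (X c) = ⊤ := by
    refine Proj.iSup_basicOpen_eq_top' _ _ (fun i => ⟨1, X_mem_one i⟩) ?_
    refine top_le_iff.mp fun p _ => ?_
    induction p using MvPolynomial.induction_on with
    | C a => exact Subalgebra.algebraMap_mem _ (algebraMap k (𝒜 0) a)
    | add p q hp hq => exact add_mem (hp trivial) (hq trivial)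
    | mul_X p j hp => exact mul_mem (hp trivial) (Algebra.subset_adjoin ⟨j, rfl⟩)
  obtain ⟨c, hc⟩ : ∃ c : Fin (n + 1),
      φ (IsLocalRing.closedPoint R) ∈ Proj.basicOpen 𝒜 (X c) :=
    TopologicalSpace.Opens.mem_iSup.mp (hcov.ge (Set.mem_univ (φ (IsLocalRing.closedPoint R))))
  have hrange : Set.range φ ⊆ Set.range (chart k c) := by
    rintro _ ⟨z, rfl⟩
    have hs : z ⤳ IsLocalRing.closedPoint R := IsLocalRing.specializes_closedPoint z
    have hz : φ z ∈ Proj.basicOpen 𝒜 (X c) :=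
      (hs.map φ.continuous).mem_open (Proj.basicOpen 𝒜 (X c)).2 hc
    rw [← Proj.opensRange_awayι 𝒜 (X c) (X_mem_one c) one_pos] at hz
    exact hz
  obtain ⟨h, hh⟩ := Spec.map_surjective (IsOpenImmersion.lift (chart k c) φ hrange)
  have hfac : Spec.map h ≫ chart k c = φ := by rw [hh, IsOpenImmersion.lift_fac]
  have hk : h.hom.comp (chartScalar c) = algebraMap k R := by
    rw [← hfac, Category.assoc, chart_structMap, ← Spec.map_comp] at hφ
    exact congrArg CommRingCat.Hom.hom (Spec.map_injective hφ)
  have hy : h.hom (ratio c c) = 1 := by rw [ratio_self, map_one]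
  refine ⟨c, fun j => h.hom (ratio c j), hy, ?_⟩
  rw [← hfac, ofCoords, ← eq_evalAway c h.hom hk _ hy fun _ => rfl, CommRingCat.ofHom_hom]

/-- Two systems of homogeneous coordinates of the same morphism are proportional. -/
lemma ofCoords_eq_ofCoords {c c' : Fin (n + 1)} {y y' : Fin (n + 1) → R} {hy : y c = 1}
    {hy' : y' c' = 1} (h : ofCoords k c y hy = ofCoords k c' y' hy') (j : Fin (n + 1)) :
    y' j = y j * y' c := by
  have hx : (X c * X c' : MvPolynomial (Fin (n + 1)) k) = X c * X c' := rfl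
  let e := Proj.pullbackAwayιIso 𝒜 (X_mem_one c) one_pos (X_mem_one c') one_pos hx
  obtain ⟨l, hl₁, hl₂⟩ : ∃ l : Spec (.of R) ⟶ pullback (Proj.awayι 𝒜 (X c) (X_mem_one c) one_pos)
      (Proj.awayι 𝒜 (X c') (X_mem_one c') one_pos),
      l ≫ pullback.fst _ _ = Spec.map (CommRingCat.ofHom (evalAway c y hy)) ∧
      l ≫ pullback.snd _ _ = Spec.map (CommRingCat.ofHom (evalAway c' y' hy')) :=
    ⟨pullback.lift _ _ h, pullback.lift_fst _ _ _, pullback.lift_snd _ _ _⟩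
  obtain ⟨H, hH⟩ := Spec.map_surjective (l ≫ e.hom)
  have h₁ : CommRingCat.ofHom (awayMap 𝒜 (X_mem_one c') hx) ≫ H =
      CommRingCat.ofHom (evalAway c y hy) := by
    apply Spec.map_injective
    rw [Spec.map_comp, hH, Category.assoc, Proj.pullbackAwayιIso_hom_SpecMap_awayMap_left, hl₁]
  have h₂ : CommRingCat.ofHom (awayMap 𝒜 (X_mem_one c) (hx.trans (mul_comm _ _))) ≫ H =
      CommRingCat.ofHom (evalAway c' y' hy') := by
    apply Spec.map_injective
    rw [Spec.map_comp, hH, Category.assoc, Proj.pullbackAwayιIso_hom_SpecMap_awayMap_right, hl₂]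
  have e₁ (i) : H.hom (awayMap 𝒜 (X_mem_one c') hx (ratio c i)) = y i := by
    rw [← evalAway_ratio (k := k) c y hy i]
    exact congrArg (fun g => g.hom (ratio c i)) h₁
  have e₂ (i) : H.hom (awayMap 𝒜 (X_mem_one c) (hx.trans (mul_comm _ _)) (ratio c' i)) = y' i := by
    rw [← evalAway_ratio (k := k) c' y' hy' i]
    exact congrArg (fun g => g.hom (ratio c' i)) h₂
  rw [← e₂ j, ← e₂ c, ← e₁ j, ← map_mul]
  congr 1
  apply val_injective
  simp only [ratio, awayMap_mk, Away.val_mk, val_mul, Localization.mk_mul]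
  rw [Localization.mk_eq_mk_iff, Localization.r_iff_exists]
  refine ⟨1, ?_⟩
  simp
  ring

end Coordinates

end ProjSpace

section Dimension

/-- Elements witnessing the strictness of a chain of primes are algebraically independent modulo
the smallest prime of the chain. -/
lemma eq_zero_of_aeval_mem_of_chain {k D : Type*} [Field k] [CommRing D] [Algebra k D] :
    ∀ {l : ℕ} (p : Fin (l + 1) → PrimeSpectrum D) (_ : Monotone p) (x : Fin l → D)
      (_ : ∀ i, x i ∈ (p i.succ).asIdeal) (_ : ∀ i, x i ∉ (p i.castSucc).asIdeal)
      (P : MvPolynomial (Fin l) k), aeval x P ∈ (p 0).asIdeal → P = 0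
  | 0, p, _, x, _, _, P, hP => by
    rw [eq_C_of_isEmpty P] at hP ⊢
    by_contra h
    rw [aeval_C] at hP
    refine (p 0).isPrime.ne_top (Ideal.eq_top_of_isUnit_mem _ hP ?_)
    exact (IsUnit.mk0 _ fun h' => h (by rw [h', C_0])).map (algebraMap k D)
  | l + 1, p, hp, x, hx, hx', P, hP => by
    let ev : Polynomial (MvPolynomial (Fin l) k) →+* D :=
      Polynomial.eval₂RingHom (aeval (fun i => x i.succ) : _ →ₐ[k] D).toRingHom (x 0)
    have hev (q) : ev q = ev q.divX * x 0 + aeval (fun i => x i.succ) (q.coeff 0) := by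
      conv_lhs => rw [← Polynomial.divX_mul_X_add q]
      simp [ev]
    have hzero (q) (hq : ev q ∈ (p 0).asIdeal) : q.coeff 0 = 0 := by
      refine eq_zero_of_aeval_mem_of_chain (fun i => p i.succ)
        (hp.comp Fin.strictMono_succ.monotone) (fun i => x i.succ) (fun i => hx i.succ)
        (fun i => hx' i.succ) (q.coeff 0) ?_
      have h1 := hp (Fin.zero_le (Fin.succ 0)) hq
      rw [hev] at h1
      exact ((p (Fin.succ 0)).asIdeal.add_mem_iff_right (Ideal.mul_mem_left _ _ (hx 0))).mp h1
    have key (j : ℕ) : ∀ q, ev q ∈ (p 0).asIdeal → q.coeff j = 0 := by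
      induction j with
      | zero => exact hzero
      | succ j ih =>
        intro q hq
        rw [← Polynomial.coeff_divX]
        refine ih _ ?_
        have h0 := hzero q hq
        rw [hev, h0, map_zero, add_zero] at hq
        exact ((p 0).isPrime.mem_or_mem hq).resolve_right (hx' 0)
    have hcomp : ev.comp (finSuccEquiv k l : _ →+* _) = (aeval x : _ →ₐ[k] D).toRingHom := by
      refine MvPolynomial.ringHom_ext (fun a => ?_) (fun i => ?_)
      · simp [ev, finSuccEquiv_apply]
      · refine Fin.cases ?_ (fun i => ?_) i <;> simp [ev, finSuccEquiv_X_zero, finSuccEquiv_X_succ]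
    have hfin : finSuccEquiv k l P = 0 := by
      ext1 j
      refine key j _ ?_
      rw [← show aeval x P = ev (finSuccEquiv k l P) from (RingHom.congr_fun hcomp P).symm]
      exact hP
    exact (EmbeddingLike.map_eq_zero_iff).mp hfin

lemma algebraicIndependent_of_chain {k D F : Type*} [Field k] [CommRing D] [Algebra k D]
    [CommRing F] [Algebra k F] (φ : D →ₐ[k] F) {l : ℕ} (p : Fin (l + 1) → PrimeSpectrum D)
    (hp : StrictMono p) (h0 : RingHom.ker φ ≤ (p 0).asIdeal) :
    ∃ x : Fin l → F, AlgebraicIndependent k x := by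
  have h (i : Fin l) : ∃ x, x ∈ (p i.succ).asIdeal ∧ x ∉ (p i.castSucc).asIdeal :=
    SetLike.exists_of_lt (hp i.castSucc_lt_succ)
  choose x hx hx' using h
  refine ⟨fun i => φ (x i), ?_⟩
  rw [algebraicIndependent_iff]
  intro P hP
  refine eq_zero_of_aeval_mem_of_chain p hp.monotone x hx hx' P (h0 ?_)
  rw [RingHom.mem_ker]
  rw [← hP]
  exact comp_aeval_apply x φ P

/-- A closed subset of a `k`-scheme has dimension at most `d` if each of its points is a
specialization of an `F`-point where `F` has transcendence degree at most `d`. -/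
lemma topologicalKrullDim_le_of_forall_specializes {k : Type} [Field k] {Y : Scheme}
    (q : Y ⟶ Spec (.of k)) {Z : Set Y} (hZ : IsClosed Z) (d : ℕ)
    (h : ∀ z ∈ Z, ∃ (F : Type) (_ : Field F) (_ : Algebra k F) (α : Spec (.of F) ⟶ Y),
      α ≫ q = Spec.map (CommRingCat.ofHom (algebraMap k F)) ∧ (∀ w, α w ⤳ z) ∧
      ∀ (l : ℕ) (x : Fin l → F), AlgebraicIndependent k x → l ≤ d) :
    topologicalKrullDim Z ≤ d := by
  refine iSup_le fun c => ?_
  suffices c.length ≤ d by exact_mod_cast this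
  obtain ⟨C, hCl, hCZ⟩ : ∃ C : LTSeries (TopologicalSpace.IrreducibleCloseds Y),
      C.length = c.length ∧ ∀ i, (C i : Set Y) ⊆ Z := by
    refine ⟨c.map _ (TopologicalSpace.IrreducibleCloseds.map_strictMono_of_isInducing
      (Topology.IsInducing.subtypeVal (t := Z))), rfl, fun i => closure_minimal ?_ hZ⟩
    rintro _ ⟨z, _, rfl⟩
    exact z.2
  rw [← hCl]
  have hirr (i) : IsIrreducible (C i : Set Y) := (C i).isIrreducible
  let g (i : Fin (C.length + 1)) : Y := (hirr i).genericPoint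
  have hg (i) : IsGenericPoint (g i) (C i : Set Y) := by
    simpa [(C i).isClosed.closure_eq] using (hirr i).isGenericPoint_genericPoint_closure
  have hgZ (i) : g i ∈ Z := hCZ i (hg i).mem
  have hgg (i j) (hij : i ≤ j) : g j ⤳ g i :=
    (hg j).specializes (C.monotone hij (hg i).mem)
  obtain ⟨F, _, _, α, hα, hspec, hF⟩ := h _ (hgZ (Fin.last _))
  obtain ⟨D, u, _, ⟨x₀, hx₀⟩, -⟩ := Scheme.exists_affine_mem_range_and_range_subset (X := Y) (U := ⊤)
    (x := g 0) trivial
  have hrange {z : Y} (hz : z ⤳ g 0) : z ∈ Set.range u :=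
    hz.mem_open u.opensRange.2 ⟨x₀, hx₀⟩
  choose x hx using fun i => hrange (hgg 0 i (Fin.zero_le _))
  have hα' : Set.range α ⊆ Set.range u := by
    refine Set.range_subset_iff.mpr fun w => ?_
    exact hrange ((hspec w).trans (hgg 0 _ (Fin.zero_le _)))
  obtain ⟨φ, hφ⟩ := Spec.map_surjective (IsOpenImmersion.lift u α hα')
  have hφα : Spec.map φ ≫ u = α := by rw [hφ, IsOpenImmersion.lift_fac]
  obtain ⟨ι, hι⟩ := Spec.map_surjective (u ≫ q)
  algebraize [ι.hom]
  let Φ : D →ₐ[k] F :=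
    { φ.hom with
      commutes' := fun a => by
        rw [← hφα, Category.assoc, ← hι, ← Spec.map_comp] at hα
        exact congrArg (fun f => f.hom a) (Spec.map_injective hα) }
  have hxle {a b : Spec D} (hab : u a ⤳ u b) :
      (show PrimeSpectrum D from a) ≤ (show PrimeSpectrum D from b) :=
    (PrimeSpectrum.le_iff_specializes _ _).mpr
      (u.isOpenEmbedding.isInducing.specializes_iff.mp hab)
  let p (i : Fin (C.length + 1)) : PrimeSpectrum D := x i.rev
  have hp : StrictMono p := by
    refine Monotone.strictMono_of_injective (fun i j hij => hxle ?_) fun i j hij => ?_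
    · rw [hx, hx]
      exact hgg _ _ (Fin.rev_le_rev.mpr hij)
    · have h1 : g i.rev = g j.rev := by
        rw [← hx, ← hx]
        exact congrArg u hij
      have h2 : C i.rev = C j.rev := by
        apply SetLike.coe_injective
        rw [← (hg _).def, ← (hg _).def, h1]
      exact Fin.rev_injective (C.strictMono.injective h2)
  have hker : RingHom.ker Φ ≤ (p 0).asIdeal := by
    let w : Spec (.of F) := (⊥ : PrimeSpectrum F)
    have h1 : (show PrimeSpectrum D from Spec.map φ w) ≤ p 0 := by
      refine hxle ?_
      rw [hx, ← Scheme.Hom.comp_apply, hφα]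
      simpa using hspec w
    exact h1
  obtain ⟨y, hy⟩ := algebraicIndependent_of_chain Φ p hp hker
  exact hF _ _ hy

end Dimension

section Valuation

/-- An algebraically independent family specializes to any prescribed values in the residue field
of a suitable valuation ring. -/
lemma exists_valuationSubring_sub_mem_nonunits {k Ω ι : Type*} [Field k] [Field Ω] [Algebra k Ω]
    {u : ι → Ω} (hu : AlgebraicIndependent k u) (v : ι → k) :
    ∃ V : ValuationSubring Ω, (∀ a, algebraMap k Ω a ∈ V) ∧
      ∀ i, u i - algebraMap k Ω (v i) ∈ V.nonunits := by
  let B := Algebra.adjoin k (Set.range u)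
  let g : B →ₐ[k] k := (aeval v).comp hu.aevalEquiv.symm.toAlgHom
  have hg (i) (hi : u i ∈ B) : g ⟨u i, hi⟩ = v i := by
    have : (⟨u i, hi⟩ : B) = hu.aevalEquiv (X i) := by
      ext
      simp [B]
    simp [g, this]
  obtain ⟨V, hV, hI⟩ := Ideal.image_subset_nonunits_valuationSubring (A := B.toSubring)
    (RingHom.ker (g : B →+* k)) (RingHom.ker_ne_top _)
  refine ⟨V, fun a => hV (B.algebraMap_mem a), fun i => hI ?_⟩
  have hi : u i ∈ B := Algebra.subset_adjoin ⟨i, rfl⟩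
  refine ⟨⟨u i, hi⟩ - algebraMap k B (v i), ?_, rfl⟩
  change g _ = 0
  rw [map_sub, hg, AlgHom.commutes]
  exact sub_self _

open ProjSpace in
/-- Linear forms, one for each index, which are specializations of algebraically independent
generic linear forms have a common zero on a proper scheme. -/
theorem exists_forall_linear_mem {k K : Type} [Field k] [Field K] [Algebra k K] {ι : Type}
    {n : ι → ℕ} {Y : Scheme} (q : Y ⟶ Spec (.of k)) [UniversallyClosed q]
    (α : Spec (.of K) ⟶ Y) (hα : α ≫ q = Spec.map (CommRingCat.ofHom (algebraMap k K)))
    (π : ∀ i, Y ⟶ ProjSpace k (n i)) (hπ : ∀ i, π i ≫ structMap k (n i) = q)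
    (c : ∀ i, Fin (n i + 1)) (y : ∀ i, Fin (n i + 1) → K) (hy : ∀ i, y i (c i) = 1)
    (h : ∀ i, α ≫ π i = ofCoords k (c i) (y i) (hy i)) {A : Type} [Finite A] (idx : A → ι)
    (L : ∀ a, Fin (n (idx a) + 1) → k)
    (hR : ∀ S : Finset A, S.Nonempty →
      (S.card : ℕ∞) ≤ (AlgebraicIndependent.matroid k K).eRk
        {z | ∃ a ∈ S, ∃ j, y (idx a) j = z}) :
    ∃ x : Y, ∀ a, ∑ j, C (L a j) * X j ∈
      ProjectiveSpectrum.asHomogeneousIdeal (π (idx a) x) := by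
  let P := MvPolynomial (Σ a, Fin (n (idx a) + 1)) K
  let Ω := FractionRing P
  have hind := (algebraicIndependent_genericForm (fun a => y (idx a)) hR).map'
    (f := IsScalarTower.toAlgHom k P Ω) (IsFractionRing.injective P Ω)
  obtain ⟨V, hkV, hV⟩ := exists_valuationSubring_sub_mem_nonunits hind
    (Sum.elim (fun p => L p.1 p.2) fun _ => 0)
  let jV : k →+* V := (algebraMap k Ω).codRestrict V.toSubring hkV
  algebraize [jV]
  let inc : V →ₐ[k] Ω := { V.subtype with commutes' := fun _ => rfl }
  let KΩ : K →ₐ[k] Ω := IsScalarTower.toAlgHom k K Ω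
  let sq : ValuativeCommSq q :=
    { R := V
      K := Ω
      i₁ := Spec.map (CommRingCat.ofHom (KΩ : K →+* Ω)) ≫ α
      i₂ := Spec.map (CommRingCat.ofHom (algebraMap k V))
      commSq := ⟨by
        rw [Category.assoc, hα, ← Spec.map_comp, ← Spec.map_comp, ← CommRingCat.ofHom_comp,
          ← CommRingCat.ofHom_comp]
        congr 2⟩ }
  have hex : ValuativeCriterion.Existence q := by
    have : UniversallyClosed q := inferInstance
    rw [UniversallyClosed.eq_valuativeCriterion] at this
    exact this.1
  obtain ⟨l, hl₁, hl₂⟩ : ∃ l : Spec (.of V) ⟶ Y,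
      Spec.map (CommRingCat.ofHom (inc : V →+* Ω)) ≫ l =
        Spec.map (CommRingCat.ofHom (KΩ : K →+* Ω)) ≫ α ∧
      l ≫ q = Spec.map (CommRingCat.ofHom (algebraMap k V)) := by
    obtain ⟨⟨l⟩⟩ := hex sq
    exact ⟨l.l, l.fac_left, l.fac_right⟩
  obtain ⟨w, hw⟩ : ∃ w : Spec (.of V), w.asIdeal = IsLocalRing.maximalIdeal V :=
    ⟨IsLocalRing.closedPoint V, rfl⟩
  refine ⟨l w, fun a => ?_⟩
  obtain ⟨d, z, hz, hlz⟩ := exists_ofCoords (l ≫ π (idx a))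
    (by rw [Category.assoc, hπ, hl₂])
  rw [← Scheme.Hom.comp_apply, hlz, mem_ofCoords_iff]
  swap
  · exact IsHomogeneous.sum _ _ _ fun j _ => by
      simpa using (isHomogeneous_C _ (L a j)).mul (isHomogeneous_X k j)
  have hcoord : ofCoords k (c (idx a)) (fun j => KΩ (y (idx a) j)) (by simp [hy]) =
      ofCoords k d (fun j => inc (z j)) (by simp [hz]) := by
    rw [← specMap_ofCoords KΩ _ _ (hy _), ← specMap_ofCoords inc _ _ hz, ← h, ← hlz,
      ← Category.assoc, ← Category.assoc]
    rw [hl₁]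
  obtain ⟨ζ, hprop⟩ : ∃ ζ, ∀ j, inc (z j) = KΩ (y (idx a) j) * ζ :=
    ⟨_, ofCoords_eq_ofCoords hcoord⟩
  have hmax {w : Ω} (hw : w ∈ V.nonunits) : ∃ e ∈ IsLocalRing.maximalIdeal V, inc e = w := by
    obtain ⟨hwV, hw⟩ := ValuationSubring.mem_nonunits_iff_exists_mem_maximalIdeal.mp hw
    exact ⟨_, hw, rfl⟩
  choose e he he' using fun j => hmax (hV (.inl ⟨a, j⟩))
  obtain ⟨t, ht, ht'⟩ := hmax (hV (.inr a))
  have hinc : Function.Injective inc := Subtype.val_injective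
  have key : aeval z (∑ j, C (L a j) * X j) + ∑ j, e j * z j = t * z (c (idx a)) := by
    apply hinc
    have h₁ (j) : inc (e j) = algebraMap P Ω (X ⟨a, j⟩) - algebraMap k Ω (L a j) := he' j
    have h₂ : inc t = ∑ j, algebraMap P Ω (X ⟨a, j⟩) * KΩ (y (idx a) j) := by
      rw [ht']
      simp only [Function.comp_apply, Sum.elim_inr, map_zero, sub_zero, genericForm, map_sum,
        map_mul]
      rfl
    simp only [map_add, map_sum, map_mul, h₁, h₂, sub_mul, Finset.sum_sub_distrib, aeval_X,
      algHom_C, AlgHom.commutes, hprop, hy, map_one, one_mul]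
    rw [add_sub_cancel]
    exact (Finset.sum_congr rfl fun _ _ => (mul_assoc _ _ _).symm).trans
      (Finset.sum_mul _ _ _).symm
  rw [eq_sub_of_add_eq key, hw]
  exact sub_mem (Ideal.mul_mem_right _ _ ht)
    (sum_mem fun j _ => Ideal.mul_mem_right _ _ (he j))

end Valuation

section Points

/-- Every point of a scheme over `k` is the image of a field-valued point over `k`. -/
lemma exists_field_point {k : Type} [Field k] {Y : Scheme} (q : Y ⟶ Spec (.of k)) (z : Y) :
    ∃ (K : Type) (_ : Field K) (_ : Algebra k K) (α : Spec (.of K) ⟶ Y),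
      α ≫ q = Spec.map (CommRingCat.ofHom (algebraMap k K)) ∧ ∀ w, α w = z := by
  obtain ⟨φ, hφ⟩ := Spec.map_surjective (Y.fromSpecResidueField z ≫ q)
  exact ⟨Y.residueField z, inferInstance, φ.hom.toAlgebra, Y.fromSpecResidueField z, hφ.symm,
    fun w => Y.fromSpecResidueField_apply z w⟩

lemma adjoin_subset_matroid_closure {k K : Type*} [Field k] [Field K] [Algebra k K] (S : Set K) :
    (IntermediateField.adjoin k S : Set K) ⊆ (AlgebraicIndependent.matroid k K).closure S := by
  rw [AlgebraicIndependent.matroid_closure_eq]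
  intro x hx
  obtain ⟨a, ha, b, hb, rfl⟩ := IntermediateField.mem_adjoin_iff_div.mp hx
  have h (c) (hc : c ∈ Algebra.adjoin k S) : IsAlgebraic (Algebra.adjoin k S) c :=
    isAlgebraic_algebraMap (⟨c, hc⟩ : Algebra.adjoin k S)
  rw [div_eq_mul_inv]
  exact (h a ha).mul (h b hb).inv

lemma card_le_eRk_of_algebraicIndependent_adjoin {k K : Type*} [Field k] [Field K] [Algebra k K]
    {S : Set K} {l : ℕ} {x : Fin l → IntermediateField.adjoin k S}
    (hx : AlgebraicIndependent k x) : (l : ℕ∞) ≤ (AlgebraicIndependent.matroid k K).eRk S := by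
  have hx' := hx.map' (f := (IntermediateField.adjoin k S).val) Subtype.val_injective
  have hind : (AlgebraicIndependent.matroid k K).Indep
      (Set.range ((IntermediateField.adjoin k S).val ∘ x)) := by
    rw [AlgebraicIndependent.matroid_indep_iff]
    exact hx'.to_subtype_range
  have hsub : Set.range ((IntermediateField.adjoin k S).val ∘ x) ⊆
      (AlgebraicIndependent.matroid k K).closure S := by
    rintro _ ⟨i, rfl⟩
    exact adjoin_subset_matroid_closure S (x i).2
  rw [← Matroid.eRk_closure_eq]
  refine le_trans (le_of_eq ?_) (Matroid.eRk_mono _ hsub)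
  rw [hind.eRk_eq_encard, ← Set.image_univ, hx'.injective.encard_image]
  simp

variable {k K ι : Type} [Field k] [Field K] [Algebra k K] [Finite ι] {m : ι → ℕ}

open ProjSpace

/-- A point of a product of projective spaces is defined over any field containing its
coordinates. -/
lemma exists_specMap_comp_eq
    (β : Spec (.of K) ⟶ (∏ᶜ fun i => ProjOver k (m i)).left)
    (hβ : β ≫ (∏ᶜ fun i => ProjOver k (m i)).hom =
      Spec.map (CommRingCat.ofHom (algebraMap k K)))
    (c : ∀ i, Fin (m i + 1)) (y : ∀ i, Fin (m i + 1) → K) (hy : ∀ i, y i (c i) = 1)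
    (h : ∀ i, β ≫ (Pi.π (fun i => ProjOver k (m i)) i).left = ofCoords k (c i) (y i) (hy i))
    (F : IntermediateField k K) (hF : ∀ i j, y i j ∈ F) :
    ∃ α : Spec (.of F) ⟶ (∏ᶜ fun i => ProjOver k (m i)).left,
      α ≫ (∏ᶜ fun i => ProjOver k (m i)).hom = Spec.map (CommRingCat.ofHom (algebraMap k F)) ∧
      Spec.map (CommRingCat.ofHom (F.val : F →+* K)) ≫ α = β := by
  let y' (i) (j : Fin (m i + 1)) : F := ⟨y i j, hF i j⟩
  have hy' (i) : y' i (c i) = 1 := Subtype.ext (hy i)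
  let α : Over.mk (Spec.map (CommRingCat.ofHom (algebraMap k F))) ⟶ ∏ᶜ fun i => ProjOver k (m i) :=
    Pi.lift fun i => Over.homMk (ofCoords k (c i) (y' i) (hy' i)) (ofCoords_structMap _ _ _)
  let γ : Over.mk (Spec.map (CommRingCat.ofHom (algebraMap k K))) ⟶
      Over.mk (Spec.map (CommRingCat.ofHom (algebraMap k F))) :=
    Over.homMk (Spec.map (CommRingCat.ofHom (F.val : F →+* K))) (by
      dsimp
      rw [← Spec.map_comp, ← CommRingCat.ofHom_comp]
      rfl)
  let β' : Over.mk (Spec.map (CommRingCat.ofHom (algebraMap k K))) ⟶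
      ∏ᶜ fun i => ProjOver k (m i) := Over.homMk β hβ
  refine ⟨α.left, Over.w α, ?_⟩
  suffices γ ≫ α = β' from congrArg CommaMorphism.left this
  refine Pi.hom_ext _ _ fun i => ?_
  ext1
  rw [Category.assoc, Pi.lift_π]
  exact (specMap_ofCoords F.val _ _ (hy' i)).trans (h i).symm

/-- The dimension of the closure of the image of an irreducible scheme in a product of projective
spaces is at most the transcendence degree of the coordinates of the generic point. -/
lemma le_eRk_of_le_topologicalKrullDim {Y : Scheme} [IrreducibleSpace Y]
    (g : Y ⟶ (∏ᶜ fun i => ProjOver k (m i)).left) (α : Spec (.of K) ⟶ Y)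
    (hα : ∀ w, α w = genericPoint Y)
    (hg : α ≫ g ≫ (∏ᶜ fun i => ProjOver k (m i)).hom =
      Spec.map (CommRingCat.ofHom (algebraMap k K)))
    (c : ∀ i, Fin (m i + 1)) (y : ∀ i, Fin (m i + 1) → K) (hy : ∀ i, y i (c i) = 1)
    (h : ∀ i, α ≫ g ≫ (Pi.π (fun i => ProjOver k (m i)) i).left =
      ofCoords k (c i) (y i) (hy i)) (N : ℕ)
    (hN : (N : WithBot ℕ∞) ≤ topologicalKrullDim (closure (Set.range g))) :
    (N : ℕ∞) ≤ (AlgebraicIndependent.matroid k K).eRk {z | ∃ i j, y i j = z} := by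
  set S := {z | ∃ i j, y i j = z} with hS
  have hfin : S.Finite := by
    have : S = Set.range fun p : Σ i, Fin (m i + 1) => y p.1 p.2 := by
      ext
      simp [hS]
    rw [this]
    exact Set.finite_range _
  obtain ⟨d, hd⟩ : ∃ d : ℕ, (AlgebraicIndependent.matroid k K).eRk S = d :=
    ENat.ne_top_iff_exists.mp
      (ne_top_of_le_ne_top hfin.encard_lt_top.ne (Matroid.eRk_le_encard _ _)) |>.imp
        fun _ => Eq.symm
  obtain ⟨α', hα'₁, hα'₂⟩ := exists_specMap_comp_eq (α ≫ g) (by rw [Category.assoc, hg]) c y hy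
    (fun i => by rw [Category.assoc, h]) (IntermediateField.adjoin k S)
    (fun i j => IntermediateField.subset_adjoin _ _ ⟨i, j, rfl⟩)
  have hdim := topologicalKrullDim_le_of_forall_specializes
    (∏ᶜ fun i => ProjOver k (m i)).hom (isClosed_closure (s := Set.range g)) d
    fun z hz => ⟨_, _, _, α', hα'₁, fun w => ?_, fun l x hx => ?_⟩
  · rw [hd]
    exact_mod_cast hN.trans hdim
  · have : α' w = g (genericPoint Y) := by
      obtain ⟨w', rfl⟩ : ∃ w' : Spec (.of K), w = Spec.map (CommRingCat.ofHom
          ((IntermediateField.adjoin k S).val : IntermediateField.adjoin k S →+* K)) w' :=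
        ⟨(⊥ : PrimeSpectrum K), Subsingleton.elim (α := PrimeSpectrum _) _ _⟩
      rw [← Scheme.Hom.comp_apply, hα'₂, Scheme.Hom.comp_apply, hα]
    rw [this, specializes_iff_mem_closure]
    refine closure_minimal ?_ isClosed_closure hz
    rintro _ ⟨v, rfl⟩
    exact ((genericPoint_specializes v).map g.continuous).mem_closure
  · have := card_le_eRk_of_algebraicIndependent_adjoin hx
    rw [hd] at this
    exact_mod_cast this

end Points

section LinearSubspace

open ProjSpace

/-- The transcendence degree of a family containing `1` is less than the dimension of its linear
span. -/
lemma eRk_range_add_one_le {k K : Type*} [Field k] [Field K] [Algebra k K] {τ : Type*} [Finite τ]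
    {y : τ → K} {c : τ} (hy : y c = 1) :
    (AlgebraicIndependent.matroid k K).eRk (Set.range y) + 1 ≤
      (Module.finrank k (Submodule.span k (Set.range y)) : ℕ∞) := by
  have hone : LinearIndepOn k id {(1 : K)} := LinearIndepOn.singleton one_ne_zero
  have hsub : {(1 : K)} ⊆ Set.range y := Set.singleton_subset_iff.mpr ⟨c, hy⟩
  set b := hone.extend hsub with hb
  have hb1 : (1 : K) ∈ b := hone.subset_extend hsub rfl
  have hbfin : b.Finite := (Set.finite_range y).subset (hone.extend_subset hsub)
  have hle : Set.range y ⊆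
      (AlgebraicIndependent.matroid k K).closure (b \ {1}) := by
    refine Set.Subset.trans ?_ (adjoin_subset_matroid_closure _)
    refine (hone.subset_span_extend hsub).trans ?_
    change Submodule.span k b ≤
      Subalgebra.toSubmodule (IntermediateField.adjoin k (b \ {1})).toSubalgebra
    refine Submodule.span_le.mpr fun x hx => ?_
    by_cases hx1 : x = 1
    · rw [hx1]
      exact one_mem (IntermediateField.adjoin k (b \ {1}))
    · exact IntermediateField.subset_adjoin k _ ⟨hx, hx1⟩
  have hcard : (Module.finrank k (Submodule.span k (Set.range y)) : ℕ∞) = b.encard := by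
    have : Fintype b := hbfin.fintype
    rw [← hone.span_extend_eq_span hsub, finrank_span_set_eq_card (hone.linearIndepOn_extend hsub),
      ← Set.ncard_eq_toFinset_card', hbfin.cast_ncard_eq]
  rw [hcard, ← Set.encard_sdiff_singleton_add_one hb1]
  gcongr
  rw [← Matroid.eRk_closure_eq]
  calc _ ≤ (AlgebraicIndependent.matroid k K).eRk
        ((AlgebraicIndependent.matroid k K).closure (b \ {1})) := by
        rw [Matroid.eRk_closure_eq]
        exact Matroid.eRk_mono _ hle
    _ ≤ _ := by
        rw [Matroid.eRk_closure_eq]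
        exact Matroid.eRk_le_encard _ _

variable {k : Type} [Field k] {n : ℕ}

lemma isClosed_linSub (T : Set (MvPolynomial (Fin (n + 1)) k)) : IsClosed (linSub k n T) :=
  ProjectiveSpectrum.isClosed_zeroLocus _ T

/-- The linear combinations of the coordinates lying in the span of a set of linear forms. -/
def coeffSpan (T : Set (MvPolynomial (Fin (n + 1)) k)) : Submodule k (Fin (n + 1) → k) :=
  (Submodule.span k T).comap (Fintype.linearCombination k X)

lemma exists_field_point_of_mem_linSub {T : Set (MvPolynomial (Fin (n + 1)) k)}
    (hT : ∀ σ ∈ T, σ.IsHomogeneous 1) {z : ProjSpace k n} (hz : z ∈ linSub k n T) :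
    ∃ (F : Type) (_ : Field F) (_ : Algebra k F) (α : Spec (.of F) ⟶ ProjSpace k n),
      α ≫ structMap k n = Spec.map (CommRingCat.ofHom (algebraMap k F)) ∧ (∀ w, α w = z) ∧
      ∀ (l : ℕ) (x : Fin l → F), AlgebraicIndependent k x →
        l + 1 + Module.finrank k (coeffSpan T) ≤ n + 1 := by
  obtain ⟨K, _, _, α, hα, hαz⟩ := exists_field_point (structMap k n) z
  obtain ⟨c, y, hy, rfl⟩ := exists_ofCoords α hα
  let F := IntermediateField.adjoin k (Set.range y)
  let y' (j : Fin (n + 1)) : F := ⟨y j, IntermediateField.subset_adjoin _ _ ⟨j, rfl⟩⟩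
  have hy' : y' c = 1 := Subtype.ext hy
  refine ⟨F, inferInstance, inferInstance, ofCoords k c y' hy', ofCoords_structMap _ _ _,
    fun w => ?_, fun l x hx => ?_⟩
  · obtain ⟨w', rfl⟩ : ∃ w' : Spec (.of K),
        w = Spec.map (CommRingCat.ofHom (F.val : F →+* K)) w' :=
      ⟨(⊥ : PrimeSpectrum K), Subsingleton.elim (α := PrimeSpectrum _) _ _⟩
    rw [← Scheme.Hom.comp_apply, specMap_ofCoords]
    exact hαz w'
  · have hker : coeffSpan T ≤ LinearMap.ker (Fintype.linearCombination k y) := by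
      intro L hL
      have hT0 : Submodule.span k T ≤ LinearMap.ker (aeval y : _ →ₐ[k] K).toLinearMap := by
        refine Submodule.span_le.mpr fun σ hσ => ?_
        obtain ⟨w, hw⟩ : ∃ w : Spec (.of K), w.asIdeal = ⊥ := ⟨(⊥ : PrimeSpectrum K), rfl⟩
        have := (mem_ofCoords_iff c y hy w σ (hT σ hσ)).mp (by rw [hαz]; exact hz σ hσ)
        rwa [hw] at this
      have := hT0 hL
      simpa [Fintype.linearCombination_apply] using this
    have h1 := card_le_eRk_of_algebraicIndependent_adjoin hx
    have h2 := eRk_range_add_one_le (k := k) hy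
    have h3 : ((l + 1 : ℕ) : ℕ∞) ≤ (Module.finrank k (Submodule.span k (Set.range y)) : ℕ∞) := by
      push_cast
      exact (add_le_add_left h1 1).trans h2
    have h4 := (Fintype.linearCombination k y).finrank_range_add_finrank_ker
    rw [Fintype.range_linearCombination] at h4
    have h5 := Submodule.finrank_mono hker
    have h6 : l + 1 ≤ Module.finrank k (Submodule.span k (Set.range y)) := by exact_mod_cast h3
    simp only [Module.finrank_fintype_fun_eq_card, Fintype.card_fin] at h4
    omega

lemma finrank_coeffSpan_le {T : Set (MvPolynomial (Fin (n + 1)) k)}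
    (hT : ∀ σ ∈ T, σ.IsHomogeneous 1) {r : ℕ} (hr : r ≤ n)
    (hdim : topologicalKrullDim (linSub k n T) = ((n - r : ℕ) : WithBot ℕ∞)) :
    Module.finrank k (coeffSpan T) ≤ r := by
  have hne : Nonempty (linSub k n T) := by
    by_contra h
    have : topologicalKrullDim (linSub k n T) = ⊥ := by
      rw [not_nonempty_iff] at h
      exact Order.krullDim_eq_bot_iff.mpr ⟨fun C => h.elim C.isIrreducible.nonempty.some⟩
    rw [this] at hdim
    exact WithBot.bot_ne_coe hdim
  obtain ⟨z, hz⟩ := hne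
  obtain ⟨F, _, _, -, -, -, h⟩ := exists_field_point_of_mem_linSub hT hz
  have h0 := h 0 Fin.elim0 algebraicIndependent_empty_type
  have hle := topologicalKrullDim_le_of_forall_specializes (structMap k n) (isClosed_linSub T)
    (n - Module.finrank k (coeffSpan T)) fun z hz => by
      obtain ⟨F, _, _, α, hα, hαz, h⟩ := exists_field_point_of_mem_linSub hT hz
      exact ⟨F, _, _, α, hα, fun w => specializes_of_eq (hαz w), fun l x hx => by
        have := h l x hx
        omega⟩
  rw [hdim] at hle
  have : n - r ≤ n - Module.finrank k (coeffSpan T) := by exact_mod_cast hle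
  omega

/-- A linear subspace of codimension `r` is cut out by `r` linear forms. -/
lemma exists_linear_forms {T : Set (MvPolynomial (Fin (n + 1)) k)}
    (hT : ∀ σ ∈ T, σ.IsHomogeneous 1) {r : ℕ} (hr : r ≤ n)
    (hdim : topologicalKrullDim (linSub k n T) = ((n - r : ℕ) : WithBot ℕ∞)) :
    ∃ L : Fin r → Fin (n + 1) → k, ∀ x : ProjSpace k n,
      (∀ a, ∑ j, C (L a j) * X j ∈ ProjectiveSpectrum.asHomogeneousIdeal x) →
      x ∈ linSub k n T := by
  let b := Module.finBasis k (coeffSpan T)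
  have hm := finrank_coeffSpan_le hT hr hdim
  refine ⟨fun a => if h : a < Module.finrank k (coeffSpan T) then b ⟨a, h⟩ else 0,
    fun x hx σ hσ => ?_⟩
  let N : Submodule k (Fin (n + 1) → k) :=
    ((ProjectiveSpectrum.asHomogeneousIdeal x).toIdeal.restrictScalars k).comap
      (Fintype.linearCombination k X)
  have hN : coeffSpan T ≤ N := by
    rw [← Submodule.map_subtype_top (coeffSpan T), ← b.span_eq, Submodule.map_span_le]
    rintro _ ⟨i, rfl⟩
    have := hx ⟨i, i.2.trans_le hm⟩
    simp only [i.2, dif_pos, ← smul_eq_C_mul] at this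
    exact this
  obtain ⟨L, rfl⟩ : σ ∈ LinearMap.range (Fintype.linearCombination k X) := by
    rw [Fintype.range_linearCombination, ← homogeneousSubmodule_one_eq_span_X]
    exact hT σ hσ
  exact hN (Submodule.subset_span hσ)

end LinearSubspace

/-- **Debarre's theorem, part (1).**  Let `k` be an algebraically closed field, `s ≥ 1`,
`n₁, …, nₛ ≥ 1` and `P = ℙ^{n₁} × ⋯ × ℙ^{nₛ}` over `k`.  Let `f : X ⟶ P` be a morphism
over `k` from a complete irreducible variety `X`, and for each `i` let `L_i ⊆ ℙ^{n_i}` be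
a linear subspace (the zero locus of a set `T i` of linear forms) of codimension
`r i ≥ 1`, i.e. `dim L_i = n_i - r_i`.  If `dim p_J(f(X)) ≥ ∑_{i ∈ J} r_i` for every
nonempty `J ⊆ {1, …, s}`, then `f⁻¹(L₁ × ⋯ × Lₛ)` is nonempty. -/
theorem debarre_part_one
    (k : Type) [Field k] [IsAlgClosed k]
    (s : ℕ) (hs : 1 ≤ s) (n : Fin s → ℕ) (hn : ∀ i, 0 < n i)
    (X : Over (Spec (CommRingCat.of k)))
    [IsReduced X.left] [IrreducibleSpace X.left] [IsProper X.hom]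
    (f : X ⟶ Pprod k s n)
    (T : ∀ i : Fin s, Set (MvPolynomial (Fin (n i + 1)) k))
    (hT : ∀ i, ∀ σ ∈ T i, σ.IsHomogeneous 1)
    (r : Fin s → ℕ) (hr : ∀ i, 0 < r i) (hrn : ∀ i, r i ≤ n i)
    (hdimL : ∀ i, topologicalKrullDim (linSub k (n i) (T i))
      = ((n i - r i : ℕ) : WithBot ℕ∞))
    (hdim : ∀ J : Finset (Fin s), J.Nonempty →
      ((∑ i ∈ J, r i : ℕ) : WithBot ℕ∞) ≤
        topologicalKrullDim (closure (Set.range ((f ≫ projJ k s n J).left.base)))) :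
    (f.left.base ⁻¹'
      ⋂ i : Fin s, (Pi.π (fun i : Fin s => ProjOver k (n i)) i).left.base ⁻¹'
        linSub k (n i) (T i)).Nonempty := by
  obtain ⟨K, _, _, α, hα, hαξ⟩ := exists_field_point X.hom (genericPoint X.left)
  let π (i : Fin s) : X.left ⟶ ProjSpace k (n i) :=
    (f ≫ Pi.π (fun i => ProjOver k (n i)) i).left
  have hπ (i) : π i ≫ ProjSpace.structMap k (n i) = X.hom :=
    Over.w (f ≫ Pi.π (fun i => ProjOver k (n i)) i)
  choose c y hy h using fun i => ProjSpace.exists_ofCoords (α ≫ π i)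
    (by rw [Category.assoc, hπ, hα])
  choose L hL using fun i => exists_linear_forms (hT i) (hrn i) (hdimL i)
  obtain ⟨x, hx⟩ := exists_forall_linear_mem X.hom α hα π hπ c y hy h
    (fun a : Σ i, Fin (r i) => a.1) (fun a => L a.1 a.2) (fun S hS => by
      let J := S.image Sigma.fst
      have hcard : S.card ≤ ∑ i ∈ J, r i := by
        refine (Finset.card_le_card (t := J.sigma fun _ => Finset.univ) fun a ha => ?_).trans
          (by simp)
        exact Finset.mem_sigma.mpr ⟨Finset.mem_image_of_mem _ ha, Finset.mem_univ _⟩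
      have hle := le_eRk_of_le_topologicalKrullDim (f ≫ projJ k s n J).left α hαξ
        (by rw [Over.w, hα]) (fun i : J => c i) (fun i => y i) (fun i => hy i)
        (fun i => by
          rw [← h, ← Over.comp_left, Category.assoc, projJ, Pi.lift_π])
        _ (hdim J (hS.image _))
      refine (Nat.cast_le.mpr hcard).trans (hle.trans_eq (congrArg _ ?_))
      ext z
      simp [J])
  refine ⟨x, Set.mem_iInter.mpr fun i => ?_⟩
  exact hL i _ fun a => hx ⟨i, a⟩

end
end

section
/- Let k be an algebraically closed field and let X be a closed irreducible subvariety of ℙⁿ over k of dimension d ≥ 2. Let H₁,…,H_r be hyperplanes of ℙⁿ with 1 ≤ r ≤ d − 1, and let Y be the set-theoretic intersection X ∩ H₁ ∩ ⋯ ∩ H_r. Then Y is nonempty and connected. -/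
/-!
The connectedness part (due to Grothendieck) of the Grothendieck–Faltings theorem
(Theorem 1.5): if `X ⊆ ℙⁿ` is a closed irreducible subvariety of dimension `d ≥ 2` and
`H₁, …, H_r` are hyperplanes with `1 ≤ r ≤ d - 1`, then `Y = X ∩ H₁ ∩ ⋯ ∩ H_r` is
nonempty and connected.
-/

open AlgebraicGeometry CategoryTheory MvPolynomial

attribute [local instance] MvPolynomial.gradedAlgebra

noncomputable section

section PolyFiltration

variable {k ι : Type*} [Field k]

/-- The ideal of polynomials all of whose monomials have degree at least `K` in the variables
from `S`. -/
def orderIdeal (k : Type*) [Field k] {ι : Type*} (S : Finset ι) (K : ℕ) :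
    Ideal (MvPolynomial ι k) where
  carrier := {f | ∀ m, coeff m f ≠ 0 → K ≤ ∑ s ∈ S, m s}
  zero_mem' := by simp
  add_mem' := by
    intro f g hf hg m hm
    rw [coeff_add] at hm
    by_cases h : coeff m f = 0
    · rw [h, zero_add] at hm
      exact hg m hm
    · exact hf m h
  smul_mem' := by
    classical
    intro c f hf m hm
    rw [smul_eq_mul, coeff_mul] at hm
    obtain ⟨⟨a, b⟩, hab, h⟩ := Finset.exists_ne_zero_of_sum_ne_zero hm
    rw [Finset.HasAntidiagonal.mem_antidiagonal] at hab
    have := hf b (right_ne_zero_of_mul h)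
    subst hab
    simp only [Finsupp.add_apply, Finset.sum_add_distrib]
    omega

lemma orderIdeal_anti (S : Finset ι) {K L : ℕ} (h : K ≤ L) :
    orderIdeal k S L ≤ orderIdeal k S K :=
  fun _ hf m hm => h.trans (hf m hm)

lemma orderIdeal_mul_le (S : Finset ι) (K L : ℕ) :
    orderIdeal k S K * orderIdeal k S L ≤ orderIdeal k S (K + L) := by
  classical
  rw [Ideal.mul_le]
  intro f hf g hg m hm
  rw [coeff_mul] at hm
  obtain ⟨⟨a, b⟩, hab, h⟩ := Finset.exists_ne_zero_of_sum_ne_zero hm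
  rw [Finset.HasAntidiagonal.mem_antidiagonal] at hab
  have h1 := hf a (left_ne_zero_of_mul h)
  have h2 := hg b (right_ne_zero_of_mul h)
  subst hab
  simp only [Finsupp.add_apply, Finset.sum_add_distrib]
  omega

lemma span_X_pow_le_orderIdeal (S : Finset ι) (K : ℕ) :
    (Ideal.span ((X : ι → MvPolynomial ι k) '' S)) ^ K ≤ orderIdeal k S K := by
  classical
  induction K with
  | zero => exact fun f _ m _ => Nat.zero_le _
  | succ K ih =>
    rw [pow_succ]
    refine (Ideal.mul_mono ih ?_).trans (orderIdeal_mul_le S K 1)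
    rw [Ideal.span_le]
    rintro _ ⟨s, hs, rfl⟩ m hm
    have hsm : m = Finsupp.single s 1 := by
      by_contra hne
      exact hm (by rw [coeff_X, if_neg (fun h => hne h.symm)])
    rw [hsm]
    calc 1 = (Finsupp.single s 1) s := by simp
      _ ≤ _ := Finset.single_le_sum (f := fun t => (Finsupp.single s 1) t)
        (fun _ _ => Nat.zero_le _) hs

lemma orderIdeal_le_span_X_pow (S : Finset ι) (K : ℕ) :
    orderIdeal k S K ≤ (Ideal.span ((X : ι → MvPolynomial ι k) '' S)) ^ K := by
  classical
  intro f hf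
  rw [f.as_sum]
  refine Ideal.sum_mem _ fun m hm => ?_
  have hK := hf m (by simpa using hm)
  rw [monomial_eq]
  refine Ideal.mul_mem_left _ _ ?_
  rw [Finsupp.prod, ← Finset.prod_filter_mul_prod_filter_not m.support (fun i => i ∈ S)]
  refine Ideal.mul_mem_right _ _ (Ideal.pow_le_pow_right hK ?_)
  have : ∑ s ∈ S, m s = ∑ s ∈ m.support with s ∈ S, m s := by
    rw [Finset.filter_mem_eq_inter, Finset.inter_comm]
    refine (Finset.sum_subset Finset.inter_subset_left ?_).symm
    intro x hx hx'
    simpa [hx] using hx'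
  rw [this]
  rw [← Finset.prod_pow_eq_pow_sum]
  refine Ideal.prod_mem_prod fun i hi => Ideal.pow_mem_pow ?_ _
  exact Ideal.subset_span ⟨i, (Finset.mem_filter.mp hi).2, rfl⟩

/-- Two polynomials of small degree which agree to high order are equal. -/
lemma eq_zero_of_mem_orderIdeal {S : Finset ι} {K : ℕ} {f : MvPolynomial ι k}
    (hf : f ∈ orderIdeal k S K) (hd : f.totalDegree < K) : f = 0 := by
  ext m
  rw [coeff_zero]
  by_contra h
  have h1 := hf m h
  have h2 := le_totalDegree (mem_support_iff.mpr h)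
  have h3 : ∑ s ∈ S, m s ≤ m.sum fun _ e => e := by
    classical
    rw [Finsupp.sum_of_support_subset (s := S ∪ m.support) m Finset.subset_union_right _ (by simp)]
    exact Finset.sum_le_sum_of_subset Finset.subset_union_left
  omega

lemma mem_orderIdeal_of_X_pow_mul_mem {S : Finset ι} {K N : ℕ} {u : ι} (hu : u ∉ S)
    {f : MvPolynomial ι k} (hf : X u ^ N * f ∈ orderIdeal k S K) : f ∈ orderIdeal k S K := by
  classical
  intro m hm
  have := hf (Finsupp.single u N + m) (by
    rwa [X_pow_eq_monomial, coeff_monomial_mul, one_mul])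
  simp only [Finsupp.add_apply, Finset.sum_add_distrib] at this
  rwa [Finset.sum_eq_zero, zero_add] at this
  intro s hs
  exact Finsupp.single_eq_of_ne (by rintro rfl; exact hu hs)

/-- If `X v ^ M * x` is divisible by `X u ^ N` modulo `orderIdeal k S K`, then so is `x`, the
quotient being given by `MvPolynomial.divMonomial`. -/
lemma X_pow_mul_divMonomial_sub_mem {S : Finset ι} {K M N : ℕ} {u v : ι} (huv : u ≠ v) (hv : v ∉ S)
    {x y : MvPolynomial ι k} (h : X v ^ M * x - X u ^ N * y ∈ orderIdeal k S K) :
    X u ^ N * (x.divMonomial (Finsupp.single u N)) - x ∈ orderIdeal k S K := by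
  classical
  intro m hm
  rw [X_pow_eq_monomial, coeff_sub, coeff_monomial_mul'] at hm
  split_ifs at hm with h1
  · rw [coeff_divMonomial, add_tsub_cancel_of_le h1, one_mul, sub_self] at hm
    exact absurd rfl hm
  · have h2 : coeff (Finsupp.single v M + m) (X v ^ M * x - X u ^ N * y) ≠ 0 := by
      rw [coeff_sub, X_pow_eq_monomial, X_pow_eq_monomial, coeff_monomial_mul, one_mul,
        coeff_monomial_mul', if_neg, sub_zero]
      · simpa using hm
      · intro h3
        apply h1
        rw [Finsupp.single_le_iff] at h3 ⊢
        rwa [Finsupp.add_apply, Finsupp.single_eq_of_ne huv, zero_add] at h3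
    have h3 := h _ h2
    simp only [Finsupp.add_apply, Finset.sum_add_distrib] at h3
    rwa [Finset.sum_eq_zero, zero_add] at h3
    intro s hs
    exact Finsupp.single_eq_of_ne (by rintro rfl; exact hv hs)

lemma totalDegree_divMonomial_single_le (x : MvPolynomial ι k) (u : ι) (N : ℕ) :
    (x.divMonomial (Finsupp.single u N)).totalDegree ≤ x.totalDegree - N := by
  classical
  rw [totalDegree, Finset.sup_le_iff]
  intro m hm
  rw [mem_support_iff, coeff_divMonomial, ← mem_support_iff] at hm
  have := le_totalDegree hm
  rw [Finsupp.sum_add_index' (by simp) (by simp), Finsupp.sum_single_index (by simp)] at this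
  omega

end PolyFiltration

section TorsionFree

variable {B : Type*} [CommRing B] [IsDomain B]

/-- An injective map of torsion-free modules has a left inverse up to a nonzero scalar. -/
lemma exists_comp_eq_smul_of_injective {M N : Type*} [AddCommGroup M] [Module B M]
    [Module.IsTorsionFree B M] [AddCommGroup N] [Module B N] [Module.FinitePresentation B N]
    (f : M →ₗ[B] N) (hf : Function.Injective f) :
    ∃ (g : N →ₗ[B] M) (c : B), c ≠ 0 ∧ ∀ x, g (f x) = c • x := by
  let S := nonZeroDivisors B
  let fS : LocalizedModule S M →ₗ[FractionRing B] LocalizedModule S N := LocalizedModule.map S f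
  have hfS : Function.Injective fS := LocalizedModule.map_injective S f hf
  obtain ⟨gS, hgS⟩ := fS.exists_leftInverse_of_injective (LinearMap.ker_eq_bot.mpr hfS)
  obtain ⟨g, s, hg⟩ := Module.FinitePresentation.exists_lift_of_isLocalizedModule S
    (LocalizedModule.mkLinearMap S M)
    ((gS.restrictScalars B) ∘ₗ LocalizedModule.mkLinearMap S N)
  refine ⟨g, s, nonZeroDivisors.ne_zero s.2, fun x => ?_⟩
  have h1 : LocalizedModule.mkLinearMap S M (g (f x)) =
      LocalizedModule.mkLinearMap S M (s.1 • x) := by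
    have h2 : LocalizedModule.mkLinearMap S N (f x) = fS (LocalizedModule.mkLinearMap S M x) := by
      simp [fS, LocalizedModule.mkLinearMap_apply]
    have h3 := LinearMap.congr_fun hg (f x)
    simp only [LinearMap.comp_apply, LinearMap.smul_apply, LinearMap.restrictScalars_apply] at h3
    rw [h3, h2, ← LinearMap.comp_apply, hgS, LinearMap.id_apply, map_smul]
    rfl
  obtain ⟨c, hc⟩ := (IsLocalizedModule.eq_iff_exists S _).mp h1
  exact smul_right_injective M (nonZeroDivisors.ne_zero c.2) hc

variable {A : Type*} [CommRing A] [Algebra B A] [Module.Finite B A] [FaithfulSMul B A]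

lemma exists_linearMap_ne_zero [IsNoetherianRing B] : ∃ φ : A →ₗ[B] B, φ ≠ 0 := by
  have := Module.finitePresentation_of_finite B A
  obtain ⟨g, c, hc, hg⟩ := exists_comp_eq_smul_of_injective (Algebra.linearMap B A)
    (FaithfulSMul.algebraMap_injective B A)
  refine ⟨g, fun h => hc ?_⟩
  have := hg 1
  rw [h] at this
  simpa using this.symm

/-- If a nonzero linear map sends all multiples of `s ^ K` into `𝔞 ^ K`, for all `K`, then `s` lies
in every prime containing `𝔞`. -/
lemma mem_of_forall_apply_pow_mul_mem [IsDomain A] [IsNoetherianRing B] (ψ : A →ₗ[B] B) (hψ : ψ ≠ 0)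
    (𝔞 : Ideal B) (s : A) (h : ∀ K a, ψ (s ^ K * a) ∈ 𝔞 ^ K) (p : Ideal A) [p.IsPrime]
    (hp : 𝔞.map (algebraMap B A) ≤ p) : s ∈ p := by
  by_contra hs
  have : IsNoetherianRing A := IsNoetherianRing.of_finite B A
  obtain ⟨n, e, he⟩ := Module.Finite.exists_fin (R := B) (M := A)
  let Θ : A →ₗ[B] (Fin n → B) := LinearMap.pi fun l => ψ ∘ₗ LinearMap.mulRight B (e l)
  have hΘ : Function.Injective Θ := by
    rw [← LinearMap.ker_eq_bot, LinearMap.ker_eq_bot']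
    intro a ha
    by_contra ha0
    have h1 : ψ ∘ₗ LinearMap.mulLeft B a = 0 := by
      apply LinearMap.ext_on_range he
      intro l
      exact congrFun ha l
    obtain ⟨b, hb0, x, hx⟩ := (Algebra.IsAlgebraic.isAlgebraic (R := B) a).exists_nonzero_dvd
      (mem_nonZeroDivisors_of_ne_zero ha0)
    apply hψ
    ext y
    have h2 := LinearMap.congr_fun h1 (x * y)
    simp only [LinearMap.comp_apply, LinearMap.mulLeft_apply, LinearMap.zero_apply] at h2
    rw [← mul_assoc, ← hx, ← Algebra.smul_def, map_smul, smul_eq_mul] at h2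
    exact (mul_eq_zero.mp h2).resolve_left hb0
  obtain ⟨Ξ, c, hc, hΞ⟩ := exists_comp_eq_smul_of_injective Θ hΘ
  have h1 : ∀ K, algebraMap B A c * s ^ K ∈ p ^ K := by
    intro K
    rw [← Algebra.smul_def, ← hΞ,
      ← LinearMap.sum_single_apply (fun _ : Fin n => B) (Θ (s ^ K)), map_sum]
    refine Ideal.sum_mem _ fun l _ => ?_
    have h2 : (Pi.single l (Θ (s ^ K) l) : Fin n → B) = (Θ (s ^ K) l) • Pi.single l 1 := by
      rw [← Pi.single_smul, smul_eq_mul, mul_one]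
    have h3 : Θ (s ^ K) l ∈ 𝔞 ^ K := h K (e l)
    rw [h2, map_smul, Algebra.smul_def]
    refine Ideal.mul_mem_right _ _ (Ideal.pow_right_mono hp K ?_)
    rw [← Ideal.map_pow]
    exact Ideal.mem_map_of_mem _ h3
  let L := Localization.AtPrime p
  have : IsNoetherianRing L := IsLocalization.isNoetherianRing p.primeCompl _ inferInstance
  have h2 : algebraMap A L (algebraMap B A c) ∈ ⨅ K, (IsLocalRing.maximalIdeal L) ^ K := by
    rw [Ideal.mem_iInf]
    intro K
    have hu : IsUnit (algebraMap A L s) := IsLocalization.map_units L (⟨s, hs⟩ : p.primeCompl)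
    rw [← Ideal.mul_unit_mem_iff_mem _ (hu.pow K), ← map_pow, ← map_mul,
      ← Localization.AtPrime.map_eq_maximalIdeal, ← Ideal.map_pow]
    exact Ideal.mem_map_of_mem _ (h1 K)
  rw [Ideal.iInf_pow_eq_bot_of_isLocalRing _ (IsLocalRing.maximalIdeal.isMaximal L).ne_top,
    Ideal.mem_bot] at h2
  have h3 := IsLocalization.injective L p.primeCompl_le_nonZeroDivisors (h2.trans (map_zero _).symm)
  exact hc (FaithfulSMul.algebraMap_injective B A (h3.trans (map_zero _).symm))

end TorsionFree

section Congruence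

variable {B A : Type*} [CommRing B] [CommRing A] [Algebra B A]

lemma apply_mem_of_mem_map (φ : A →ₗ[B] B) {𝔟 : Ideal B} {x : A}
    (hx : x ∈ 𝔟.map (algebraMap B A)) : φ x ∈ 𝔟 := by
  have h1 : x ∈ (𝔟 • (⊤ : Submodule B A)) := by
    rw [Ideal.smul_top_eq_map]
    exact hx
  have h2 := Submodule.mem_map_of_mem (f := φ) h1
  rw [Submodule.map_smul''] at h2
  exact Submodule.smul_le.mpr (fun b hb y _ => 𝔟.mul_mem_right y hb) h2

variable {I J : Ideal A} {𝔞 : Ideal B}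

lemma apply_mul_mul_mem (hIJ : I * J ≤ 𝔞.map (algebraMap B A)) (φ : A →ₗ[B] B) {K : ℕ} {x y : A}
    (hx : x ∈ I ^ K) (hy : y ∈ J ^ K)
    (a : A) : φ (x * y * a) ∈ 𝔞 ^ K := by
  apply apply_mem_of_mem_map
  rw [Ideal.map_pow]
  refine Ideal.mul_mem_right _ _ (Ideal.pow_right_mono hIJ K ?_)
  rw [mul_pow]
  exact Ideal.mul_mem_mul hx hy

lemma mul_apply_sub_mul_apply_mem (hIJ : I * J ≤ 𝔞.map (algebraMap B A))
    (φ : A →ₗ[B] B) {K : ℕ} {b b' : B} {i j i' j' : A}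
    (hi : i ∈ I ^ K) (hj : j ∈ J ^ K) (hi' : i' ∈ I ^ K) (hj' : j' ∈ J ^ K)
    (hb : algebraMap B A b = i + j) (hb' : algebraMap B A b' = i' + j') (a : A) :
    b' * φ (i * a) - b * φ (i' * a) ∈ 𝔞 ^ K := by
  have h : b' * φ (i * a) - b * φ (i' * a) = φ (i * j' * a) - φ (i' * j * a) := by
    rw [← smul_eq_mul b', ← smul_eq_mul b, ← map_smul φ b', ← map_smul φ b, ← map_sub, ← map_sub,
      Algebra.smul_def, Algebra.smul_def, hb, hb']
    congr 1
    ring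
  rw [h]
  exact sub_mem (apply_mul_mul_mem hIJ φ hi hj' a) (apply_mul_mul_mem hIJ φ hi' hj a)

end Congruence

section Splitting

variable {k ι : Type*} [Field k]

lemma span_X_pow_eq_orderIdeal (S : Finset ι) (K : ℕ) :
    (Ideal.span ((X : ι → MvPolynomial ι k) '' S)) ^ K = orderIdeal k S K :=
  (span_X_pow_le_orderIdeal S K).antisymm (orderIdeal_le_span_X_pow S K)

variable {A : Type*} [CommRing A] [Algebra (MvPolynomial ι k) A]

/-- The element `ψ a` is the limit of `φ (i K * a) / X u ^ N K` for the filtration by order. -/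
lemma exists_forall_X_pow_mul_sub_mem {S : Finset ι} {u v : ι} (huv : u ≠ v) (hu : u ∉ S)
    (hv : v ∉ S) {I J : Ideal A}
    (hIJ : I * J ≤ (Ideal.span ((X : ι → MvPolynomial ι k) '' S)).map (algebraMap _ A))
    {N N' : ℕ → ℕ} {i j i' j' : ℕ → A}
    (hi : ∀ K, i K ∈ I ^ K) (hj : ∀ K, j K ∈ J ^ K)
    (hi' : ∀ K, i' K ∈ I ^ K) (hj' : ∀ K, j' K ∈ J ^ K)
    (hij : ∀ K, algebraMap (MvPolynomial ι k) A (X u ^ N K) = i K + j K)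
    (hij' : ∀ K, algebraMap (MvPolynomial ι k) A (X v ^ N' K) = i' K + j' K)
    (φ : A →ₗ[MvPolynomial ι k] MvPolynomial ι k) (a : A)
    (hdeg : ∃ C, ∀ K, (φ (i K * a)).totalDegree ≤ N K + C) :
    ∃ x, ∀ K, X u ^ N K * x - φ (i K * a) ∈ orderIdeal k S K := by
  obtain ⟨C, hC⟩ := hdeg
  let ψ : ℕ → MvPolynomial ι k := fun K => (φ (i K * a)).divMonomial (Finsupp.single u (N K))
  have h1 : ∀ K, X u ^ N K * ψ K - φ (i K * a) ∈ orderIdeal k S K := by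
    intro K
    refine X_pow_mul_divMonomial_sub_mem huv hv (M := N' K) (y := φ (i' K * a)) ?_
    rw [← span_X_pow_eq_orderIdeal]
    exact mul_apply_sub_mul_apply_mem hIJ φ (hi K) (hj K) (hi' K) (hj' K) (hij K) (hij' K) a
  have h2 : ∀ K L, K ≤ L → ψ K - ψ L ∈ orderIdeal k S K := by
    intro K L hKL
    refine mem_orderIdeal_of_X_pow_mul_mem hu (N := N K + N L) ?_
    have h3 : X u ^ N L * φ (i K * a) - X u ^ N K * φ (i L * a) ∈ orderIdeal k S K := by
      rw [← span_X_pow_eq_orderIdeal]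
      exact mul_apply_sub_mul_apply_mem hIJ φ (hi K) (hj K) (Ideal.pow_le_pow_right hKL (hi L))
        (Ideal.pow_le_pow_right hKL (hj L)) (hij K) (hij L) a
    have h4 := (orderIdeal k S K).mul_mem_left (X u ^ N L) (h1 K)
    have h5 := (orderIdeal k S K).mul_mem_left (X u ^ N K) (orderIdeal_anti S hKL (h1 L))
    convert sub_mem (add_mem h4 h3) h5 using 1
    ring
  have h3 : ∀ K, (ψ K).totalDegree ≤ C := fun K =>
    (totalDegree_divMonomial_single_le _ _ _).trans (by have := hC K; omega)
  refine ⟨ψ (C + 1), fun K => ?_⟩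
  rcases le_total K (C + 1) with hK | hK
  · convert sub_mem (h1 K) ((orderIdeal k S K).mul_mem_left (X u ^ N K) (h2 K _ hK)) using 1
    ring
  · have h4 : ψ (C + 1) - ψ K = 0 := by
      refine eq_zero_of_mem_orderIdeal (h2 _ _ hK) (lt_of_le_of_lt (totalDegree_sub _ _) ?_)
      exact Nat.lt_succ_of_le (max_le (h3 _) (h3 _))
    rw [sub_eq_zero.mp h4]
    exact h1 K

lemma eq_zero_of_forall_X_pow_mul_mem {S : Finset ι} {u : ι} (hu : u ∉ S) {N : ℕ → ℕ}
    {x : MvPolynomial ι k} (h : ∀ K, X u ^ N K * x ∈ orderIdeal k S K) : x = 0 :=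
  eq_zero_of_mem_orderIdeal (mem_orderIdeal_of_X_pow_mul_mem hu (h (x.totalDegree + 1)))
    (Nat.lt_succ_self _)

/-- A finite extension of a polynomial ring cannot be disconnected along the coordinate subspace
`X s = 0` (`s ∈ S`), if two further variables, `u` and `v`, are available. -/
theorem false_of_separated [Finite ι] [IsDomain A] [Module.Finite (MvPolynomial ι k) A]
    [FaithfulSMul (MvPolynomial ι k) A] {S : Finset ι} {u v : ι} (huv : u ≠ v) (hu : u ∉ S)
    (hv : v ∉ S) {I J : Ideal A}
    (hIJ : I * J ≤ (Ideal.span ((X : ι → MvPolynomial ι k) '' S)).map (algebraMap _ A))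
    {N N' : ℕ → ℕ} {i j i' j' : ℕ → A}
    (hi : ∀ K, i K ∈ I ^ K) (hj : ∀ K, j K ∈ J ^ K)
    (hi' : ∀ K, i' K ∈ I ^ K) (hj' : ∀ K, j' K ∈ J ^ K)
    (hij : ∀ K, algebraMap (MvPolynomial ι k) A (X u ^ N K) = i K + j K)
    (hij' : ∀ K, algebraMap (MvPolynomial ι k) A (X v ^ N' K) = i' K + j' K)
    (hdeg : ∀ (φ : A →ₗ[MvPolynomial ι k] MvPolynomial ι k) (a : A),
      ∃ C, ∀ K, (φ (i K * a)).totalDegree ≤ N K + C)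
    {p q : Ideal A} [p.IsPrime] [q.IsPrime]
    (hp : (Ideal.span ((X : ι → MvPolynomial ι k) '' S)).map (algebraMap _ A) ≤ p)
    (hq : (Ideal.span ((X : ι → MvPolynomial ι k) '' S)).map (algebraMap _ A) ≤ q)
    (hJp : ¬ J ≤ p) (hIq : ¬ I ≤ q) : False := by
  obtain ⟨φ, hφ⟩ := exists_linearMap_ne_zero (B := MvPolynomial ι k) (A := A)
  choose ψ hψ using fun a => exists_forall_X_pow_mul_sub_mem huv hu hv hIJ hi hj hi' hj' hij hij'
    φ a (hdeg φ a)
  let Ψ : A →ₗ[MvPolynomial ι k] MvPolynomial ι k :=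
    { toFun := ψ
      map_add' := by
        intro a b
        rw [← sub_eq_zero]
        refine eq_zero_of_forall_X_pow_mul_mem hu (N := N) fun K => ?_
        convert sub_mem (sub_mem (hψ (a + b) K) (hψ a K)) (hψ b K) using 1
        rw [mul_add, map_add]
        ring
      map_smul' := by
        intro c a
        rw [← sub_eq_zero]
        refine eq_zero_of_forall_X_pow_mul_mem hu (N := N) fun K => ?_
        convert sub_mem (hψ (c • a) K) ((orderIdeal k S K).mul_mem_left c (hψ a K)) using 1
        rw [mul_smul_comm, map_smul, RingHom.id_apply, smul_eq_mul, smul_eq_mul]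
        ring }
  have h1 : ∀ s ∈ J, ∀ K a, Ψ (s ^ K * a) ∈ Ideal.span ((X : ι → MvPolynomial ι k) '' S) ^ K := by
    intro s hs K a
    have h2 := apply_mul_mul_mem hIJ φ (hi K) (Ideal.pow_mem_pow hs K) a
    rw [span_X_pow_eq_orderIdeal] at h2 ⊢
    refine mem_orderIdeal_of_X_pow_mul_mem hu (N := N K) ?_
    convert add_mem (hψ (s ^ K * a) K) h2 using 1
    rw [mul_assoc]
    exact (sub_add_cancel _ _).symm
  have h2 : ∀ s ∈ I, ∀ K a,
      (φ - Ψ) (s ^ K * a) ∈ Ideal.span ((X : ι → MvPolynomial ι k) '' S) ^ K := by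
    intro s hs K a
    have h2 := apply_mul_mul_mem hIJ φ (Ideal.pow_mem_pow hs K) (hj K) a
    rw [span_X_pow_eq_orderIdeal] at h2 ⊢
    refine mem_orderIdeal_of_X_pow_mul_mem hu (N := N K) ?_
    convert sub_mem h2 (hψ (s ^ K * a) K) using 1
    have h3 : X u ^ N K * φ (s ^ K * a) = φ (i K * (s ^ K * a)) + φ (s ^ K * j K * a) := by
      rw [← smul_eq_mul, ← map_smul, Algebra.smul_def, hij, ← map_add]
      congr 1
      ring
    rw [LinearMap.sub_apply, mul_sub, h3]
    change _ - X u ^ N K * ψ _ = _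
    ring
  by_cases h0 : Ψ = 0
  · refine hIq fun s hs => mem_of_forall_apply_pow_mul_mem (φ - Ψ) ?_ _ s (h2 s hs) q hq
    rwa [h0, sub_zero]
  · exact hJp fun s hs => mem_of_forall_apply_pow_mul_mem Ψ h0 _ s (h1 s hs) p hp

end Splitting

/-- The irrelevant ideal of a graded algebra, as an ideal. -/
def irrelevantIdeal {k A : Type*} [Field k] [CommRing A] [Algebra k A] (𝒜 : ℕ → Submodule k A)
    [GradedAlgebra 𝒜] : Ideal A :=
  (HomogeneousIdeal.irrelevant 𝒜).toIdeal

section GradedIdeals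

variable {k A : Type*} [Field k] [CommRing A] [Algebra k A] (𝒜 : ℕ → Submodule k A)
  [GradedAlgebra 𝒜]

lemma mem_irrelevantIdeal_iff {x : A} :
    x ∈ irrelevantIdeal 𝒜 ↔ (DirectSum.decompose 𝒜 x 0 : A) = 0 :=
  HomogeneousIdeal.mem_irrelevant_iff 𝒜 x

lemma mem_irrelevantIdeal_of_mem {e : ℕ} (he : 0 < e) {x : A} (hx : x ∈ 𝒜 e) :
    x ∈ irrelevantIdeal 𝒜 := by
  rw [mem_irrelevantIdeal_iff, DirectSum.decompose_of_mem_ne 𝒜 hx he.ne']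

lemma isPrime_irrelevantIdeal [IsDomain A] : (irrelevantIdeal 𝒜).IsPrime := by
  rw [irrelevantIdeal, HomogeneousIdeal.toIdeal_irrelevant]
  exact RingHom.ker_isPrime _

lemma isHomogeneous_irrelevantIdeal : (irrelevantIdeal 𝒜).IsHomogeneous 𝒜 :=
  (HomogeneousIdeal.irrelevant 𝒜).isHomogeneous

variable {𝒜}

lemma le_irrelevantIdeal (h0 : ∀ x ∈ 𝒜 0, ∃ c : k, algebraMap k A c = x) {I : Ideal A}
    (hI : I.IsHomogeneous 𝒜) (hI' : I ≠ ⊤) : I ≤ irrelevantIdeal 𝒜 := by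
  intro x hx
  rw [mem_irrelevantIdeal_iff]
  have h1 := hI 0 hx
  obtain ⟨c, hc⟩ := h0 _ (SetLike.coe_mem (DirectSum.decompose 𝒜 x 0))
  rw [← hc] at h1 ⊢
  by_contra hc0
  have hc1 : c ≠ 0 := by
    rintro rfl
    exact hc0 (map_zero _)
  exact hI' (Ideal.eq_top_of_isUnit_mem _ h1 ((IsUnit.mk0 c hc1).map (algebraMap k A)))

lemma isHomogeneous_of_mem_minimalPrimes {I p : Ideal A} (hI : I.IsHomogeneous 𝒜)
    (hp : p ∈ I.minimalPrimes) : p.IsHomogeneous 𝒜 := by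
  have h1 : (p.homogeneousCore 𝒜).toIdeal.IsPrime := hp.1.1.homogeneousCore
  have h2 : I ≤ (p.homogeneousCore 𝒜).toIdeal := by
    rw [← hI.toIdeal_homogeneousCore_eq_self]
    exact Ideal.homogeneousCore_mono 𝒜 hp.1.2
  have h3 := hp.2 ⟨h1, h2⟩ (Ideal.toIdeal_homogeneousCore_le 𝒜 p)
  rw [h3.antisymm (Ideal.toIdeal_homogeneousCore_le 𝒜 p)]
  exact (p.homogeneousCore 𝒜).isHomogeneous

/-- Homogeneous prime avoidance, for finitely many incomparable primes. -/
lemma exists_homogeneous_notMem (T : Finset (Ideal A)) {J : Ideal A} (hJ : J.IsHomogeneous 𝒜)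
    (hT : ∀ p ∈ T, p.IsPrime) (hTh : ∀ p ∈ T, p.IsHomogeneous 𝒜)
    (hanti : ∀ p ∈ T, ∀ q ∈ T, p ≤ q → p = q) (hTJ : ∀ p ∈ T, ¬ J ≤ p)
    (hTm : ∀ p ∈ T, ¬ irrelevantIdeal 𝒜 ≤ p) :
    ∃ N, 0 < N ∧ ∃ g ∈ J, g ∈ 𝒜 N ∧ ∀ p ∈ T, g ∉ p := by
  classical
  induction T using Finset.induction_on with
  | empty => exact ⟨1, one_pos, 0, zero_mem _, zero_mem _, by simp⟩
  | insert p T hpT ih =>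
    simp only [Finset.forall_mem_insert] at hT hTh hanti hTJ hTm
    obtain ⟨N, hN, g, hgJ, hgN, hg⟩ := ih hT.2 hTh.2 (fun q hq q' hq' => (hanti.2 q hq).2 q' hq')
      hTJ.2 hTm.2
    by_cases hgp : g ∈ p
    swap
    · exact ⟨N, hN, g, hgJ, hgN, by simpa [hgp] using hg⟩
    have h1 : ¬ (J ⊓ irrelevantIdeal 𝒜) ⊓ T.inf id ≤ p := by
      rw [hT.1.inf_le, hT.1.inf_le, hT.1.inf_le']
      rintro ((h | h) | ⟨q, hq, hqp⟩)
      · exact hTJ.1 h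
      · exact hTm.1 h
      · exact hpT (((hanti.2 q hq).1 hqp) ▸ hq)
    obtain ⟨x, ⟨⟨hxJ, hxm⟩, hxT⟩, hxp⟩ := SetLike.not_le_iff_exists.mp h1
    rw [Ideal.IsHomogeneous.mem_iff 𝒜 hTh.1] at hxp
    push Not at hxp
    obtain ⟨e, he⟩ := hxp
    have he0 : 0 < e := by
      rw [Nat.pos_iff_ne_zero]
      rintro rfl
      rw [SetLike.mem_coe, mem_irrelevantIdeal_iff] at hxm
      exact he (hxm ▸ zero_mem _)
    set h : A := (DirectSum.decompose 𝒜 x e : A) with hdef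
    have hhe : h ∈ 𝒜 e := SetLike.coe_mem _
    have hhT : ∀ q ∈ T, h ∈ q := fun q hq => hTh.2 q hq e ((Finset.inf_le (f := id) hq) hxT)
    refine ⟨e * N, Nat.mul_pos he0 hN, g ^ e + h ^ N,
      add_mem (J.pow_mem_of_mem hgJ e he0) (J.pow_mem_of_mem (hJ e hxJ) N hN),
      add_mem (by simpa using SetLike.pow_mem_graded e hgN)
        (by simpa [mul_comm] using SetLike.pow_mem_graded N hhe), ?_⟩
    rw [Finset.forall_mem_insert]
    refine ⟨fun hc => he ?_, fun q hq hc => hg q hq ?_⟩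
    · exact hT.1.mem_of_pow_mem N (((p.add_mem_iff_right (p.pow_mem_of_mem hgp e he0)).mp hc))
    · exact (hT.2 q hq).mem_of_pow_mem e
        ((q.add_mem_iff_left (q.pow_mem_of_mem (hhT q hq) N hN)).mp hc)

lemma add_one_le_height_sup_span_singleton {I : Ideal A} {i : ℕ} (hi : (i : ℕ∞) ≤ I.height) {g : A}
    (hg : ∀ p ∈ I.minimalPrimes, g ∈ p → (i + 1 : ℕ∞) ≤ p.height) :
    ((i + 1 : ℕ) : ℕ∞) ≤ (I ⊔ Ideal.span {g}).height := by
  rw [Ideal.height_eq_inf_minimalPrimes]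
  refine le_iInf₂ fun p hp => ?_
  have := hp.1.1
  obtain ⟨q, hq, hqp⟩ := Ideal.exists_minimalPrimes_le (le_sup_left.trans hp.1.2)
  have := hq.1.1
  have hgp : g ∈ p := hp.1.2 (le_sup_right (a := I) (Ideal.mem_span_singleton_self g))
  push_cast
  by_cases hgq : g ∈ q
  · exact (hg q hq hgq).trans (Ideal.height_mono hqp)
  · refine le_trans ?_ (Ideal.height_add_one_le_of_lt_of_isPrime
      (lt_of_le_of_ne hqp (by rintro rfl; exact hgq hgp)))
    gcongr
    exact hi.trans (Ideal.height_mono hq.1.2)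

lemma exists_homogeneous_add_one_le_height [IsNoetherianRing A] [IsDomain A]
    (h0 : ∀ x ∈ 𝒜 0, ∃ c : k, algebraMap k A c = x) {I : Ideal A} (hI : I.IsHomogeneous 𝒜) {i : ℕ}
    (hi : (i : ℕ∞) ≤ I.height) (hD : (i + 1 : ℕ∞) ≤ (irrelevantIdeal 𝒜).height) :
    ∃ N, 0 < N ∧ ∃ g ∈ 𝒜 N, ((i + 1 : ℕ) : ℕ∞) ≤ (I ⊔ Ideal.span {g}).height := by
  classical
  let T := (Ideal.finite_minimalPrimes_of_isNoetherianRing A I).toFinset.erase (irrelevantIdeal 𝒜)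
  have hTmem : ∀ {p}, p ∈ T → p ∈ I.minimalPrimes := fun hp => by
    simpa using Finset.mem_of_mem_erase hp
  obtain ⟨N, hN, g, -, hgN, hg⟩ := exists_homogeneous_notMem T (isHomogeneous_irrelevantIdeal 𝒜)
    (fun p hp => (hTmem hp).1.1) (fun p hp => isHomogeneous_of_mem_minimalPrimes hI (hTmem hp))
    (fun p hp q hq hpq => hpq.antisymm ((hTmem hq).2 (hTmem hp).1 hpq))
    (fun p hp h => Finset.ne_of_mem_erase hp ((le_irrelevantIdeal h0
      (isHomogeneous_of_mem_minimalPrimes hI (hTmem hp)) (hTmem hp).1.1.ne_top).antisymm h))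
    (fun p hp h => Finset.ne_of_mem_erase hp ((le_irrelevantIdeal h0
      (isHomogeneous_of_mem_minimalPrimes hI (hTmem hp)) (hTmem hp).1.1.ne_top).antisymm h))
  refine ⟨N, hN, g, hgN, add_one_le_height_sup_span_singleton hi fun p hp hgp => ?_⟩
  by_cases hpm : p = irrelevantIdeal 𝒜
  · rwa [hpm]
  · exact absurd hgp (hg p (by simp [T, hpm, hp]))

lemma exists_extension_le_height [IsNoetherianRing A] [IsDomain A]
    (h0 : ∀ x ∈ 𝒜 0, ∃ c : k, algebraMap k A c = x) {I : Ideal A} (hI : I.IsHomogeneous 𝒜) {i : ℕ}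
    (hi : (i : ℕ∞) ≤ I.height) (e : ℕ) (hD : ((i + e : ℕ) : ℕ∞) ≤ (irrelevantIdeal 𝒜).height) :
    ∃ f : Fin e → A, (∀ j, ∃ N, 0 < N ∧ f j ∈ 𝒜 N) ∧
      ((i + e : ℕ) : ℕ∞) ≤ (I ⊔ Ideal.span (Set.range f)).height := by
  induction e with
  | zero => exact ⟨Fin.elim0, fun j => j.elim0, by simpa using hi⟩
  | succ e ih =>
    obtain ⟨f, hf, hf'⟩ := ih (le_trans (by exact_mod_cast Nat.le_succ (i + e)) hD)
    have hI' : (I ⊔ Ideal.span (Set.range f)).IsHomogeneous 𝒜 := by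
      refine hI.sup (Ideal.homogeneous_span _ _ ?_)
      rintro _ ⟨j, rfl⟩
      obtain ⟨N, -, hN⟩ := hf j
      exact ⟨N, hN⟩
    obtain ⟨N, hN, g, hgN, hg⟩ := exists_homogeneous_add_one_le_height h0 hI' hf'
      (by exact_mod_cast hD)
    refine ⟨Fin.snoc f g, Fin.lastCases ⟨N, hN, by simpa using hgN⟩ (by simpa using hf), ?_⟩
    rw [Fin.range_snoc, Set.insert_eq, Ideal.span_union, sup_comm (Ideal.span {g}), ← sup_assoc]
    exact hg

lemma irrelevantIdeal_le_radical [IsNoetherianRing A] [IsDomain A]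
    (h0 : ∀ x ∈ 𝒜 0, ∃ c : k, algebraMap k A c = x) {I : Ideal A} (hI : I.IsHomogeneous 𝒜)
    (h : (irrelevantIdeal 𝒜).height ≤ I.height) : irrelevantIdeal 𝒜 ≤ I.radical := by
  rw [← Ideal.sInf_minimalPrimes]
  refine le_sInf fun p hp => ?_
  have := hp.1.1
  have := isPrime_irrelevantIdeal 𝒜
  exact (Ideal.eq_of_le_of_height_le p (le_irrelevantIdeal h0
    (isHomogeneous_of_mem_minimalPrimes hI hp) hp.1.1.ne_top)
    (h.trans (Ideal.height_mono hp.1.2))).ge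

end GradedIdeals

section NoetherNormalization

variable {k A κ : Type*} [Field k] [CommRing A]

lemma algebraMap_injective_of_card_le_height [Fintype κ] [Algebra (MvPolynomial κ k) A]
    [Algebra.IsIntegral (MvPolynomial κ k) A]
    (m : Ideal A) [m.IsPrime] (hm : (Fintype.card κ : ℕ∞) ≤ m.height) :
    Function.Injective (algebraMap (MvPolynomial κ k) A) := by
  rw [injective_iff_map_eq_zero]
  by_contra! h
  obtain ⟨r, hr, hr0⟩ := h
  let f : (MvPolynomial κ k ⧸ Ideal.span {r}) →+* A :=
    Ideal.Quotient.lift _ (algebraMap (MvPolynomial κ k) A) (by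
      intro a ha
      obtain ⟨c, rfl⟩ := Ideal.mem_span_singleton'.mp ha
      rw [map_mul, hr, mul_zero])
  have hf : f.IsIntegral := by
    intro x
    obtain ⟨p, hp, hpx⟩ := Algebra.IsIntegral.isIntegral (R := MvPolynomial κ k) x
    refine ⟨p.map (Ideal.Quotient.mk _), hp.map _, ?_⟩
    rw [Polynomial.eval₂_map]
    exact hpx
  have h1 : ringKrullDim A ≤ ringKrullDim (MvPolynomial κ k ⧸ Ideal.span {r}) := by
    let := f.toAlgebra
    have : Algebra.IsIntegral (MvPolynomial κ k ⧸ Ideal.span {r}) A := ⟨hf⟩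
    refine Order.krullDim_le_of_strictMono (PrimeSpectrum.comap f) fun p q hpq => ?_
    exact Ideal.IsIntegral.comap_lt_comap hpq
  have h2 := ringKrullDim_quotient_succ_le_of_nonZeroDivisor (mem_nonZeroDivisors_of_ne_zero hr0)
  rw [MvPolynomial.ringKrullDim_of_isNoetherianRing, ringKrullDim_eq_zero_of_field, zero_add,
    Nat.card_eq_fintype_card] at h2
  have h3 : ((Fintype.card κ : ℕ∞) : WithBot ℕ∞) ≤ ringKrullDim A :=
    (WithBot.coe_le_coe.mpr hm).trans (Ideal.height_le_ringKrullDim_of_isPrime)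
  have h4 := (add_le_add_left (h3.trans h1) 1).trans h2
  have h5 : Fintype.card κ + 1 ≤ Fintype.card κ := by exact_mod_cast h4
  omega

variable [Algebra k A] {𝒜 : ℕ → Submodule k A}

lemma exists_totalDegree_le_of_graded_le_span [Algebra (MvPolynomial κ k) A]
    [IsScalarTower k (MvPolynomial κ k) A] {G : Finset A} {δ : ℕ} (hδ : 0 < δ)
    (hG : ∀ e, 𝒜 e ≤ Submodule.span k {x | ∃ b : MvPolynomial κ k, ∃ g ∈ G,
      b.totalDegree * δ ≤ e ∧ algebraMap (MvPolynomial κ k) A b * g = x})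
    (φ : A →ₗ[MvPolynomial κ k] MvPolynomial κ k) (y : A) :
    ∃ C, ∀ N, ∀ a ∈ 𝒜 (N * δ), (φ (a * y)).totalDegree ≤ N + C := by
  refine ⟨G.sup fun g => (φ (g * y)).totalDegree, fun N a ha => ?_⟩
  set C := G.sup fun g => (φ (g * y)).totalDegree
  have h := (Submodule.span_le (p := (restrictTotalDegree κ k (N + C)).comap
    ((φ.restrictScalars k) ∘ₗ LinearMap.mulRight k y))).mpr ?_ (hG _ ha)
  · rwa [Submodule.mem_comap, mem_restrictTotalDegree] at h
  · rintro _ ⟨b, g, hg, hb, rfl⟩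
    rw [SetLike.mem_coe, Submodule.mem_comap, mem_restrictTotalDegree]
    have h1 : φ (algebraMap (MvPolynomial κ k) A b * g * y) = b * φ (g * y) := by
      rw [mul_assoc, ← Algebra.smul_def, map_smul, smul_eq_mul]
    simp only [LinearMap.comp_apply, LinearMap.mulRight_apply, LinearMap.restrictScalars_apply, h1]
    refine (totalDegree_mul _ _).trans (add_le_add (Nat.le_of_mul_le_mul_right hb hδ) ?_)
    exact Finset.le_sup (f := fun g => (φ (g * y)).totalDegree) hg

variable [GradedAlgebra 𝒜]

lemma exists_sum_mul_eq_of_mem_span [Fintype κ] {F : κ → A} {δ e : ℕ} (hF : ∀ i, F i ∈ 𝒜 δ)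
    (hδ : δ ≤ e) {a : A} (ha : a ∈ 𝒜 e) (ha' : a ∈ Ideal.span (Set.range F)) :
    ∃ c : κ → A, (∀ i, c i ∈ 𝒜 (e - δ)) ∧ ∑ i, c i * F i = a := by
  obtain ⟨c, hc⟩ := Ideal.mem_span_range_iff_exists_fun.mp ha'
  refine ⟨fun i => DirectSum.decompose 𝒜 (c i) (e - δ), fun i => SetLike.coe_mem _, ?_⟩
  conv_rhs => rw [← DirectSum.decompose_of_mem_same 𝒜 ha, ← hc, DirectSum.decompose_sum]
  rw [DFinsupp.finsetSum_apply, AddSubmonoidClass.coe_finsetSum]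
  exact Finset.sum_congr rfl fun i _ =>
    (DirectSum.coe_decompose_mul_of_right_mem_of_le 𝒜 (hF i) hδ).symm

variable [Algebra (MvPolynomial κ k) A]

lemma exists_finset_graded_le_span [Fintype κ] [IsNoetherianRing A]
    (hfin : ∀ e, (𝒜 e).FG) (hstd : ∀ e, ∀ a ∈ 𝒜 e, a ∈ irrelevantIdeal 𝒜 ^ e) {δ : ℕ}
    (hδ : 0 < δ) (hF : ∀ i, algebraMap (MvPolynomial κ k) A (X i) ∈ 𝒜 δ)
    (hrad : irrelevantIdeal 𝒜 ≤
      (Ideal.span (Set.range fun i => algebraMap (MvPolynomial κ k) A (X i))).radical) :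
    ∃ G : Finset A, ∀ e, 𝒜 e ≤ Submodule.span k {x | ∃ b : MvPolynomial κ k, ∃ g ∈ G,
      b.totalDegree * δ ≤ e ∧ algebraMap (MvPolynomial κ k) A b * g = x} := by
  classical
  obtain ⟨M, hM⟩ := Ideal.exists_pow_le_of_le_radical_of_fg hrad (IsNoetherian.noetherian _)
  choose S hS using hfin
  let G := (Finset.range (max M δ)).biUnion S
  refine ⟨G, fun e => ?_⟩
  induction e using Nat.strong_induction_on with
  | _ e ih =>
    by_cases he : e < max M δ
    · rw [← hS e]
      refine Submodule.span_mono fun g hg => ⟨1, g, ?_, by simp, by simp⟩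
      exact Finset.mem_biUnion.mpr ⟨e, Finset.mem_range.mpr he, hg⟩
    · rw [not_lt, max_le_iff] at he
      intro a ha
      obtain ⟨c, hc, rfl⟩ := exists_sum_mul_eq_of_mem_span hF he.2 ha
        (hM (Ideal.pow_le_pow_right he.1 (hstd e a ha)))
      refine Submodule.sum_mem _ fun i _ => ?_
      have h1 := ih (e - δ) (by omega) (hc i)
      refine (Submodule.span_le (p := (Submodule.span k _).comap
        (LinearMap.mulRight k (algebraMap (MvPolynomial κ k) A (X i))))).mpr ?_ h1
      rintro _ ⟨b, g, hg, hb, rfl⟩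
      refine Submodule.subset_span ⟨b * X i, g, hg, ?_, ?_⟩
      · have h2 := totalDegree_mul b (X i : MvPolynomial κ k)
        rw [totalDegree_X] at h2
        calc _ ≤ (b.totalDegree + 1) * δ := Nat.mul_le_mul_right _ h2
          _ ≤ e := by rw [add_mul]; omega
      · rw [map_mul, LinearMap.mulRight_apply]
        ring

lemma finite_of_graded_le_span [IsScalarTower k (MvPolynomial κ k) A] {G : Finset A} {δ : ℕ}
    (hG : ∀ e, 𝒜 e ≤ Submodule.span k {x | ∃ b : MvPolynomial κ k, ∃ g ∈ G,
      b.totalDegree * δ ≤ e ∧ algebraMap (MvPolynomial κ k) A b * g = x}) :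
    Module.Finite (MvPolynomial κ k) A := by
  classical
  refine ⟨G, top_unique fun a _ => ?_⟩
  rw [← DirectSum.sum_support_decompose 𝒜 a]
  refine Submodule.sum_mem _ fun e _ => ?_
  have h1 := hG e (SetLike.coe_mem (DirectSum.decompose 𝒜 a e))
  refine (Submodule.span_le (p := (Submodule.span (MvPolynomial κ k) (G : Set A)).restrictScalars
    k)).mpr ?_ h1
  rintro _ ⟨b, g, hg, -, rfl⟩
  rw [← Algebra.smul_def]
  exact Submodule.smul_mem _ b (Submodule.subset_span hg)

end NoetherNormalization

/-- A graded algebra over a field, with one-dimensional degree zero part and finite-dimensional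
homogeneous components, which is generated in degree one. -/
structure IsStandardGraded {k A : Type*} [Field k] [CommRing A] [Algebra k A]
    (𝒜 : ℕ → Submodule k A) [GradedAlgebra 𝒜] : Prop where
  exists_algebraMap_eq : ∀ x ∈ 𝒜 0, ∃ c : k, algebraMap k A c = x
  fg : ∀ e, (𝒜 e).FG
  mem_pow : ∀ e, ∀ a ∈ 𝒜 e, a ∈ irrelevantIdeal 𝒜 ^ e

section Parameters

variable {k A : Type*} [Field k] [CommRing A] [Algebra k A] {𝒜 : ℕ → Submodule k A}
  [GradedAlgebra 𝒜]

lemma isHomogeneous_span_range {ι : Type*} {f : ι → A} (hf : ∀ i, ∃ N, 0 < N ∧ f i ∈ 𝒜 N) :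
    (Ideal.span (Set.range f)).IsHomogeneous 𝒜 := by
  refine Ideal.homogeneous_span _ _ ?_
  rintro _ ⟨i, rfl⟩
  obtain ⟨N, -, hN⟩ := hf i
  exact ⟨N, hN⟩

/-- A partial system of parameters extends, up to powers, to a full system of parameters whose
elements all have the same degree. -/
lemma exists_parameters [IsNoetherianRing A] [IsDomain A] (h𝒜 : IsStandardGraded 𝒜) {ι : Type*}
    [Fintype ι] {f : ι → A} (hf : ∀ i, ∃ N, 0 < N ∧ f i ∈ 𝒜 N)
    (hht : (Fintype.card ι : ℕ∞) ≤ (Ideal.span (Set.range f)).height) {e : ℕ}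
    (hD : (irrelevantIdeal 𝒜).height = ((Fintype.card ι + e : ℕ) : ℕ∞)) :
    ∃ (F : ι ⊕ Fin e → A) (δ : ℕ), 0 < δ ∧ (∀ j, F j ∈ 𝒜 δ) ∧
      (∀ i, ∃ n, 0 < n ∧ F (.inl i) = f i ^ n) ∧
      irrelevantIdeal 𝒜 ≤ (Ideal.span (Set.range F)).radical := by
  classical
  obtain ⟨f', hf', hht'⟩ := exists_extension_le_height h𝒜.exists_algebraMap_eq
    (isHomogeneous_span_range hf) hht e hD.ge
  let F₀ := Sum.elim f f'
  have hF₀ : ∀ j, ∃ N, 0 < N ∧ F₀ j ∈ 𝒜 N := by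
    rintro (i | i)
    exacts [hf i, hf' i]
  choose N hN hFN using hF₀
  have hpos : 0 < ∏ j, N j := Finset.prod_pos fun j _ => hN j
  have hdvd : ∀ j, N j ∣ ∏ j, N j := fun j => Finset.dvd_prod_of_mem N (Finset.mem_univ j)
  have hnpos : ∀ j, 0 < (∏ j, N j) / N j := fun j =>
    Nat.div_pos (Nat.le_of_dvd hpos (hdvd j)) (hN j)
  refine ⟨fun j => F₀ j ^ ((∏ j, N j) / N j), ∏ j, N j, hpos, fun j => ?_,
    fun i => ⟨_, hnpos _, rfl⟩, ?_⟩
  · have := SetLike.pow_mem_graded ((∏ j, N j) / N j) (hFN j)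
    rwa [smul_eq_mul, Nat.div_mul_cancel (hdvd j)] at this
  · have h1 : Ideal.span (Set.range F₀) = Ideal.span (Set.range f) ⊔ Ideal.span (Set.range f') := by
      rw [← Ideal.span_union, ← Set.Sum.elim_range]
    have h2 : irrelevantIdeal 𝒜 ≤ (Ideal.span (Set.range F₀)).radical := by
      refine irrelevantIdeal_le_radical h𝒜.exists_algebraMap_eq
        (isHomogeneous_span_range fun j => ⟨N j, hN j, hFN j⟩) ?_
      rw [h1, hD]
      exact hht'
    refine h2.trans (Ideal.radical_le_radical_iff.mpr (Ideal.span_le.mpr ?_))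
    rintro _ ⟨j, rfl⟩
    exact ⟨_, Ideal.subset_span ⟨j, rfl⟩⟩

end Parameters

lemma isPrime_span_X_image {R κ : Type*} [CommRing R] [IsDomain R] (s : Set κ) :
    (Ideal.span ((X : κ → MvPolynomial κ R) '' s)).IsPrime := by
  classical
  let g : MvPolynomial κ R →ₐ[R] MvPolynomial κ R := aeval fun i => if i ∈ s then 0 else X i
  have h : Ideal.span ((X : κ → MvPolynomial κ R) '' s) = RingHom.ker g := by
    apply le_antisymm
    · rw [Ideal.span_le]
      rintro _ ⟨i, hi, rfl⟩
      simp [g, hi]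
    · intro x hx
      have h1 : (Ideal.Quotient.mkₐ R (Ideal.span ((X : κ → MvPolynomial κ R) '' s))).comp g
          = Ideal.Quotient.mkₐ R (Ideal.span ((X : κ → MvPolynomial κ R) '' s)) := by
        ext i
        by_cases hi : i ∈ s
        · have h2 : (X i : MvPolynomial κ R) ∈ Ideal.span ((X : κ → MvPolynomial κ R) '' s) :=
            Ideal.subset_span ⟨i, hi, rfl⟩
          simp [g, hi, (Ideal.Quotient.eq_zero_iff_mem.mpr h2)]
        · simp [g, hi]
      have h2 := AlgHom.congr_fun h1 x
      rw [AlgHom.comp_apply, RingHom.mem_ker.mp hx, map_zero] at h2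
      exact Ideal.Quotient.eq_zero_iff_mem.mp h2.symm
  rw [h]
  exact RingHom.ker_isPrime _

lemma X_mem_span_X_image_iff {R κ : Type*} [CommRing R] [Nontrivial R] {s : Set κ} {i : κ} :
    (X i : MvPolynomial κ R) ∈ Ideal.span ((X : κ → MvPolynomial κ R) '' s) ↔ i ∈ s := by
  classical
  refine ⟨fun h => ?_, fun h => Ideal.subset_span ⟨i, h, rfl⟩⟩
  rw [mem_ideal_span_X_image] at h
  obtain ⟨j, hj, hj'⟩ := h (Finsupp.single i 1) (by simp [support_X])
  rw [Finsupp.single_apply_ne_zero] at hj'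
  exact hj'.1 ▸ hj

section Moving

variable {k A : Type*} [Field k] [CommRing A] [Algebra k A] {𝒜 : ℕ → Submodule k A}
  [GradedAlgebra 𝒜]

/-- A homogeneous prime containing a partial system of parameters can be enlarged so that it lies in
no minimal prime of the ideal generated by these parameters. -/
lemma exists_isPrime_not_le_minimalPrimes [IsNoetherianRing A] [IsDomain A]
    (h𝒜 : IsStandardGraded 𝒜) {ι : Type*} [Fintype ι] {f : ι → A}
    (hf : ∀ i, ∃ N, 0 < N ∧ f i ∈ 𝒜 N)
    (hht : (Fintype.card ι : ℕ∞) ≤ (Ideal.span (Set.range f)).height) {e : ℕ}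
    (hD : (irrelevantIdeal 𝒜).height = ((Fintype.card ι + (e + 2) : ℕ) : ℕ∞))
    {p : Ideal A} [p.IsPrime] (hph : p.IsHomogeneous 𝒜) (hpm : ¬ irrelevantIdeal 𝒜 ≤ p)
    (hfp : Ideal.span (Set.range f) ≤ p) :
    ∃ q : Ideal A, q.IsPrime ∧ q.IsHomogeneous 𝒜 ∧ ¬ irrelevantIdeal 𝒜 ≤ q ∧ p ≤ q ∧
      ∀ r ∈ (Ideal.span (Set.range f)).minimalPrimes, ¬ q ≤ r := by
  by_cases hp : ∀ r ∈ (Ideal.span (Set.range f)).minimalPrimes, ¬ p ≤ r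
  · exact ⟨p, inferInstance, hph, hpm, le_rfl, hp⟩
  push Not at hp
  obtain ⟨r, hr, hpr⟩ := hp
  obtain rfl : p = r := hpr.antisymm (hr.2 ⟨inferInstance, hfp⟩ hpr)
  obtain ⟨F, δ, hδ, hF, hFf, hrad⟩ := exists_parameters h𝒜 hf hht hD
  let := (aeval (R := k) F).toAlgebra
  have hX : ∀ j, algebraMap (MvPolynomial (ι ⊕ Fin (e + 2)) k) A (X j) = F j :=
    fun j => aeval_X (R := k) F j
  have : IsScalarTower k (MvPolynomial (ι ⊕ Fin (e + 2)) k) A :=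
    IsScalarTower.of_algHom (aeval (R := k) F)
  obtain ⟨G, hG⟩ := exists_finset_graded_le_span (κ := ι ⊕ Fin (e + 2)) h𝒜.fg h𝒜.mem_pow hδ
    (by simpa only [hX] using hF) (by simpa only [hX] using hrad)
  have := finite_of_graded_le_span hG
  have := isPrime_irrelevantIdeal 𝒜
  have hinj := algebraMap_injective_of_card_le_height (k := k) (κ := ι ⊕ Fin (e + 2))
    (irrelevantIdeal 𝒜) (by rw [hD]; simp)
  have : FaithfulSMul (MvPolynomial (ι ⊕ Fin (e + 2)) k) A :=
    (faithfulSMul_iff_algebraMap_injective _ _).mpr hinj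
  let P₀ : Ideal (MvPolynomial (ι ⊕ Fin (e + 2)) k) := Ideal.span (X '' (Set.range Sum.inl))
  let P₁ : Ideal (MvPolynomial (ι ⊕ Fin (e + 2)) k) :=
    Ideal.span (X '' (insert (Sum.inr 0) (Set.range Sum.inl)))
  have hP₀ : P₀.IsPrime := isPrime_span_X_image _
  have hP₁ : P₁.IsPrime := isPrime_span_X_image _
  have hle : P₀ ≤ p.under (MvPolynomial (ι ⊕ Fin (e + 2)) k) := by
    rw [Ideal.span_le]
    rintro _ ⟨_, ⟨i, rfl⟩, rfl⟩
    rw [SetLike.mem_coe, Ideal.under_def, Ideal.mem_comap, hX]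
    obtain ⟨n, hn, hFn⟩ := hFf i
    rw [hFn]
    exact p.pow_mem_of_mem (hfp (Ideal.subset_span ⟨i, rfl⟩)) n hn
  have hP₀p : p.under (MvPolynomial (ι ⊕ Fin (e + 2)) k) = P₀ := by
    obtain ⟨Q, hQp, hQ, hQP⟩ := Ideal.exists_ideal_le_liesOver_of_le p hle
    have hfQ : Ideal.span (Set.range f) ≤ Q := by
      rw [Ideal.span_le]
      rintro _ ⟨i, rfl⟩
      obtain ⟨n, hn, hFn⟩ := hFf i
      refine hQ.mem_of_pow_mem n ?_
      rw [← hFn, ← hX]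
      change X (Sum.inl i) ∈ Q.under _
      rw [← hQP.over]
      exact Ideal.subset_span ⟨_, ⟨i, rfl⟩, rfl⟩
    have hQ' : Q = p := hQp.antisymm (hr.2 ⟨hQ, hfQ⟩ hQp)
    rw [← hQ', ← hQP.over]
  have hP₀₁ : P₀ ≤ P₁ := Ideal.span_mono (Set.image_mono (Set.subset_insert _ _))
  obtain ⟨Q, hpQ, hQ, hQP⟩ := Ideal.exists_ideal_over_prime_of_isIntegral_of_isPrime P₁ p
    (hP₀p.le.trans hP₀₁)
  have hXQ : ∀ j, F j ∈ Q ↔ j ∈ insert (Sum.inr 0) (Set.range (Sum.inl : ι → ι ⊕ Fin (e + 2))) := by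
    intro j
    rw [← X_mem_span_X_image_iff (R := k), ← hX, ← Ideal.mem_comap, hQP]
  refine ⟨(Q.homogeneousCore 𝒜).toIdeal, hQ.homogeneousCore, (Q.homogeneousCore 𝒜).isHomogeneous,
    fun h => ?_, ?_, fun s hs hQs => ?_⟩
  · have h1 := Ideal.toIdeal_homogeneousCore_le 𝒜 Q
      (h (mem_irrelevantIdeal_of_mem 𝒜 hδ (hF (.inr 1))))
    rw [hXQ] at h1
    simp at h1
  · rw [← hph.toIdeal_homogeneousCore_eq_self]
    exact Ideal.homogeneousCore_mono 𝒜 hpQ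
  · have hpcore : p ≤ (Q.homogeneousCore 𝒜).toIdeal := by
      rw [← hph.toIdeal_homogeneousCore_eq_self]
      exact Ideal.homogeneousCore_mono 𝒜 hpQ
    have hsp := hs.2 ⟨inferInstance, hfp⟩ (hpcore.trans hQs)
    have h1 : F (.inr 0) ∈ (Q.homogeneousCore 𝒜).toIdeal :=
      Ideal.mem_homogeneousCore_of_homogeneous_of_mem ⟨δ, hF _⟩ ((hXQ _).mpr (by simp))
    have h2 : F (.inr 0) ∈ p := hsp (hQs h1)
    rw [← hX, ← Ideal.mem_comap, ← Ideal.under_def, hP₀p, X_mem_span_X_image_iff] at h2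
    simp at h2

end Moving

section Replacement

variable {k A : Type*} [Field k] [CommRing A] [Algebra k A] {𝒜 : ℕ → Submodule k A}
  [GradedAlgebra 𝒜]

/-- A linear form `l` can be replaced by a homogeneous element of the shape `l ^ N + g` which,
together with given parameters, is again part of a system of parameters and cuts out a smaller
locus. -/
lemma exists_add_one_le_height_mem_radical [IsNoetherianRing A] 
    (h𝒜 : IsStandardGraded 𝒜) {I : Ideal A} (hI : I.IsHomogeneous 𝒜) {i : ℕ}
    (hht : (i : ℕ∞) ≤ I.height) {l : A} (hl : l ∈ 𝒜 1)
    {q₁ q₂ : Ideal A} (hq₁ : q₁.IsPrime) (hq₁h : q₁.IsHomogeneous 𝒜)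
    (hq₂h : q₂.IsHomogeneous 𝒜) (hl₁ : l ∈ q₁) (hl₂ : l ∈ q₂)
    (h₁ : ∀ p ∈ I.minimalPrimes, ¬ q₁ ≤ p) (h₂ : ∀ p ∈ I.minimalPrimes, ¬ q₂ ≤ p) :
    ∃ N, 0 < N ∧ ∃ f ∈ 𝒜 N, f ∈ q₁ ∧ f ∈ q₂ ∧ l ∈ (I ⊔ Ideal.span {f}).radical ∧
      ((i + 1 : ℕ) : ℕ∞) ≤ (I ⊔ Ideal.span {f}).height := by
  classical
  let T := (Ideal.finite_minimalPrimes_of_isNoetherianRing A I).toFinset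
  have hT : ∀ {p}, p ∈ T ↔ p ∈ I.minimalPrimes := fun {p} => by simp [T]
  let Tβ := T.filter fun p => l ∉ p
  let J := q₁ ⊓ q₂ ⊓ Tβ.inf id
  have hJ : J.IsHomogeneous 𝒜 := by
    refine (hq₁h.inf hq₂h).inf (Finset.inf_induction (Ideal.IsHomogeneous.top 𝒜)
      (fun a ha b hb => ha.inf hb) fun p hp => ?_)
    exact isHomogeneous_of_mem_minimalPrimes hI (hT.mp (Finset.mem_filter.mp hp).1)
  have hα : ∀ {p}, p ∈ T.filter (fun p => l ∈ p) ↔ p ∈ I.minimalPrimes ∧ l ∈ p := fun {p} => by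
    rw [Finset.mem_filter, hT]
  obtain ⟨N, hN, g, hgJ, hgN, hg⟩ := exists_homogeneous_notMem (T.filter fun p => l ∈ p) hJ
    (fun p hp => (hα.mp hp).1.1.1)
    (fun p hp => isHomogeneous_of_mem_minimalPrimes hI (hα.mp hp).1)
    (fun p hp q hq hpq => hpq.antisymm ((hα.mp hq).1.2 (hα.mp hp).1.1 hpq))
    (fun p hp h => by
      have hp' := hα.mp hp
      have hpp := hp'.1.1.1
      rw [hpp.inf_le, hpp.inf_le, hpp.inf_le'] at h
      obtain ((h | h) | ⟨q, hq, hqp⟩) := h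
      · exact h₁ p hp'.1 h
      · exact h₂ p hp'.1 h
      · rw [Finset.mem_filter, hT] at hq
        exact hq.2 (hp'.1.2 hq.1.1 hqp hp'.2))
    (fun p hp h => h₁ p (hα.mp hp).1
      ((le_irrelevantIdeal h𝒜.exists_algebraMap_eq hq₁h hq₁.ne_top).trans h))
  have hgβ : ∀ p ∈ I.minimalPrimes, l ∉ p → g ∈ p := fun p hp hlp =>
    Finset.inf_le (f := id) (Finset.mem_filter.mpr ⟨hT.mpr hp, hlp⟩) hgJ.2
  have hf : ∀ p ∈ I.minimalPrimes, l ^ N + g ∉ p := by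
    intro p hp hfp
    by_cases hlp : l ∈ p
    · exact hg p (hα.mpr ⟨hp, hlp⟩)
        ((p.add_mem_iff_right (p.pow_mem_of_mem hlp N hN)).mp hfp)
    · exact hlp (hp.1.1.mem_of_pow_mem N ((p.add_mem_iff_left (hgβ p hp hlp)).mp hfp))
  refine ⟨N, hN, l ^ N + g, add_mem (by simpa using SetLike.pow_mem_graded N hl) hgN,
    add_mem (q₁.pow_mem_of_mem hl₁ N hN) hgJ.1.1, add_mem (q₂.pow_mem_of_mem hl₂ N hN) hgJ.1.2, ?_,
    add_one_le_height_sup_span_singleton hht fun p hp hfp => absurd hfp (hf p hp)⟩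
  rw [Ideal.radical_eq_sInf, Submodule.mem_sInf]
  rintro P ⟨hIP, hP⟩
  obtain ⟨p, hp, hpP⟩ := Ideal.exists_minimalPrimes_le (le_sup_left.trans hIP)
  by_cases hlp : l ∈ p
  · exact hpP hlp
  · have hfP : l ^ N + g ∈ P := hIP (le_sup_right (a := I) (Ideal.mem_span_singleton_self _))
    exact hP.mem_of_pow_mem N ((P.add_mem_iff_left (hpP (hgβ p hp hlp))).mp hfP)

/-- Linear forms can be replaced by part of a system of parameters cutting out a smaller locus,
without losing two prescribed points up to specialization. -/
lemma exists_parameters_of_linear_forms [IsNoetherianRing A] [IsDomain A]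
    (h𝒜 : IsStandardGraded 𝒜) {r D : ℕ} (hD : (irrelevantIdeal 𝒜).height = (D : ℕ∞))
    (hrD : r + 2 ≤ D) {l : Fin r → A} (hl : ∀ i, l i ∈ 𝒜 1) {p₁ p₂ : Ideal A}
    (hp₁ : p₁.IsPrime) (hp₂ : p₂.IsPrime) (hp₁h : p₁.IsHomogeneous 𝒜) (hp₂h : p₂.IsHomogeneous 𝒜)
    (hp₁m : ¬ irrelevantIdeal 𝒜 ≤ p₁) (hp₂m : ¬ irrelevantIdeal 𝒜 ≤ p₂)
    (hl₁ : ∀ i, l i ∈ p₁) (hl₂ : ∀ i, l i ∈ p₂) (i : ℕ) (hi : i ≤ r) :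
    ∃ f : Fin i → A, (∀ j, ∃ N, 0 < N ∧ f j ∈ 𝒜 N) ∧
      (i : ℕ∞) ≤ (Ideal.span (Set.range f)).height ∧
      (∀ j : Fin r, j.1 < i → l j ∈ (Ideal.span (Set.range f)).radical) ∧
      (∃ q : Ideal A, q.IsPrime ∧ q.IsHomogeneous 𝒜 ∧ ¬ irrelevantIdeal 𝒜 ≤ q ∧ p₁ ≤ q ∧
        Ideal.span (Set.range f) ≤ q) ∧
      (∃ q : Ideal A, q.IsPrime ∧ q.IsHomogeneous 𝒜 ∧ ¬ irrelevantIdeal 𝒜 ≤ q ∧ p₂ ≤ q ∧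
        Ideal.span (Set.range f) ≤ q) := by
  induction i with
  | zero =>
    refine ⟨Fin.elim0, fun j => j.elim0, by simp, fun j hj => absurd hj (Nat.not_lt_zero _),
      ⟨p₁, hp₁, hp₁h, hp₁m, le_rfl, ?_⟩, ⟨p₂, hp₂, hp₂h, hp₂m, le_rfl, ?_⟩⟩ <;>
    simp
  | succ i ih =>
    obtain ⟨f, hf, hht, hlf, ⟨q₁, hq₁, hq₁h, hq₁m, hpq₁, hfq₁⟩,
      ⟨q₂, hq₂, hq₂h, hq₂m, hpq₂, hfq₂⟩⟩ :=
      ih (by omega)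
    have hD' : (irrelevantIdeal 𝒜).height
        = ((Fintype.card (Fin i) + ((D - i - 2) + 2) : ℕ) : ℕ∞) := by
      rw [hD, Fintype.card_fin]
      congr 1
      omega
    have hht' : (Fintype.card (Fin i) : ℕ∞) ≤ (Ideal.span (Set.range f)).height := by
      rwa [Fintype.card_fin]
    obtain ⟨s₁, hs₁, hs₁h, hs₁m, hqs₁, hs₁f⟩ :=
      exists_isPrime_not_le_minimalPrimes h𝒜 hf hht' hD' hq₁h hq₁m hfq₁
    obtain ⟨s₂, hs₂, hs₂h, hs₂m, hqs₂, hs₂f⟩ :=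
      exists_isPrime_not_le_minimalPrimes h𝒜 hf hht' hD' hq₂h hq₂m hfq₂
    obtain ⟨N, hN, g, hgN, hg₁, hg₂, hlg, hg⟩ := exists_add_one_le_height_mem_radical h𝒜
      (isHomogeneous_span_range hf) hht (hl ⟨i, hi⟩) hs₁ hs₁h hs₂h
      (hqs₁ (hpq₁ (hl₁ _))) (hqs₂ (hpq₂ (hl₂ _))) hs₁f hs₂f
    have hspan : Ideal.span (Set.range (Fin.snoc f g : Fin (i + 1) → A))
        = Ideal.span (Set.range f) ⊔ Ideal.span {g} := by
      rw [Fin.range_snoc, Set.insert_eq, Ideal.span_union, sup_comm]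
    refine ⟨Fin.snoc f g, Fin.lastCases ⟨N, hN, by simpa using hgN⟩ (by simpa using hf), ?_⟩
    rw [hspan]
    refine ⟨hg, fun j hj => ?_, ⟨s₁, hs₁, hs₁h, hs₁m, hpq₁.trans hqs₁, sup_le (hfq₁.trans hqs₁) ?_⟩,
      ⟨s₂, hs₂, hs₂h, hs₂m, hpq₂.trans hqs₂, sup_le (hfq₂.trans hqs₂) ?_⟩⟩
    · rcases Nat.lt_succ_iff_lt_or_eq.mp hj with h | h
      · exact Ideal.radical_mono le_sup_left (hlf j h)
      · obtain rfl : j = ⟨i, hi⟩ := Fin.ext h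
        exact hlg
    · rwa [Ideal.span_singleton_le_iff_mem]
    · rwa [Ideal.span_singleton_le_iff_mem]

end Replacement

section Connectedness

variable {k A : Type*} [Field k] [CommRing A] [Algebra k A] {𝒜 : ℕ → Submodule k A}
  [GradedAlgebra 𝒜]

lemma isHomogeneous_pow {I : Ideal A} (hI : I.IsHomogeneous 𝒜) (n : ℕ) :
    (I ^ n).IsHomogeneous 𝒜 := by
  induction n with
  | zero =>
    rw [pow_zero, Ideal.one_eq_top]
    exact Ideal.IsHomogeneous.top 𝒜
  | succ n ih =>
    rw [pow_succ]
    exact ih.mul hI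

lemma exists_add_eq_of_mem_sup {I J : Ideal A} (hI : I.IsHomogeneous 𝒜) (hJ : J.IsHomogeneous 𝒜)
    {e : ℕ} {a : A} (ha : a ∈ 𝒜 e) (haIJ : a ∈ I ⊔ J) :
    ∃ i j, i ∈ I ∧ j ∈ J ∧ i ∈ 𝒜 e ∧ a = i + j := by
  obtain ⟨i, hi, j, hj, rfl⟩ := Submodule.mem_sup.mp haIJ
  refine ⟨DirectSum.decompose 𝒜 i e, DirectSum.decompose 𝒜 j e, hI e hi, hJ e hj,
    SetLike.coe_mem _, ?_⟩
  conv_lhs => rw [← DirectSum.decompose_of_mem_same 𝒜 ha, DirectSum.decompose_add]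
  rfl

lemma exists_pow_eq_add [IsNoetherianRing A] {I J : Ideal A} (hI : I.IsHomogeneous 𝒜)
    (hJ : J.IsHomogeneous 𝒜)
    (hdisj : ∀ q : Ideal A, q.IsPrime → q.IsHomogeneous 𝒜 → I ≤ q → J ≤ q → irrelevantIdeal 𝒜 ≤ q)
    {δ : ℕ} (hδ : 0 < δ) {x : A} (hx : x ∈ 𝒜 δ) (K : ℕ) :
    ∃ N i j, i ∈ I ^ K ∧ j ∈ J ^ K ∧ i ∈ 𝒜 (N * δ) ∧ x ^ N = i + j := by
  have hIK := isHomogeneous_pow hI K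
  have hJK := isHomogeneous_pow hJ K
  have h : x ∈ (I ^ K ⊔ J ^ K).radical := by
    rw [← Ideal.sInf_minimalPrimes, Submodule.mem_sInf]
    intro p hp
    have hpp := hp.1.1
    exact hdisj p hpp (isHomogeneous_of_mem_minimalPrimes (hIK.sup hJK) hp)
      (hpp.le_of_pow_le (le_sup_left.trans hp.1.2)) (hpp.le_of_pow_le (le_sup_right.trans hp.1.2))
      (mem_irrelevantIdeal_of_mem 𝒜 hδ hx)
  obtain ⟨N, hN⟩ := h
  obtain ⟨i, j, hi, hj, hid, hij⟩ :=
    exists_add_eq_of_mem_sup hIK hJK (SetLike.pow_mem_graded N hx) hN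
  exact ⟨N, i, j, hi, hj, hid, hij⟩

/-- The locus of a standard graded domain `A` of dimension `D` cut out by at most `D - 2` linear
forms is connected. -/
theorem false_of_disconnected [IsNoetherianRing A] [IsDomain A]
    (h𝒜 : IsStandardGraded 𝒜) {r D : ℕ} (hD : (irrelevantIdeal 𝒜).height = (D : ℕ∞))
    (hrD : r + 2 ≤ D) {l : Fin r → A} (hl : ∀ i, l i ∈ 𝒜 1) {I J : Ideal A}
    (hI : I.IsHomogeneous 𝒜) (hJ : J.IsHomogeneous 𝒜)
    (hlI : ∀ i, l i ∈ I) (hlJ : ∀ i, l i ∈ J)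
    (hcover : ∀ q : Ideal A, q.IsPrime → q.IsHomogeneous 𝒜 → ¬ irrelevantIdeal 𝒜 ≤ q →
      (∀ i, l i ∈ q) → I ≤ q ∨ J ≤ q)
    (hdisj : ∀ q : Ideal A, q.IsPrime → q.IsHomogeneous 𝒜 → I ≤ q → J ≤ q → irrelevantIdeal 𝒜 ≤ q)
    {p₁ p₂ : Ideal A} (hp₁ : p₁.IsPrime) (hp₂ : p₂.IsPrime)
    (hp₁h : p₁.IsHomogeneous 𝒜) (hp₂h : p₂.IsHomogeneous 𝒜)
    (hp₁m : ¬ irrelevantIdeal 𝒜 ≤ p₁) (hp₂m : ¬ irrelevantIdeal 𝒜 ≤ p₂)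
    (hIp₁ : I ≤ p₁) (hJp₂ : J ≤ p₂) : False := by
  obtain ⟨f, hf, hht, hlf, ⟨q₁, hq₁, hq₁h, hq₁m, hpq₁, hfq₁⟩,
      ⟨q₂, hq₂, hq₂h, hq₂m, hpq₂, hfq₂⟩⟩ :=
    exists_parameters_of_linear_forms h𝒜 hD hrD hl hp₁ hp₂ hp₁h hp₂h hp₁m hp₂m
      (fun i => hIp₁ (hlI i)) (fun i => hJp₂ (hlJ i)) r le_rfl
  have hIm : I ≤ irrelevantIdeal 𝒜 :=
    hIp₁.trans (le_irrelevantIdeal h𝒜.exists_algebraMap_eq hp₁h hp₁.ne_top)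
  have hIJ : I * J ≤ (Ideal.span (Set.range f)).radical := by
    rw [← Ideal.sInf_minimalPrimes]
    refine le_sInf fun p hp => ?_
    have hpp := hp.1.1
    by_cases hpm : irrelevantIdeal 𝒜 ≤ p
    · exact Ideal.mul_le_left.trans (hIm.trans hpm)
    · rcases hcover p hpp (isHomogeneous_of_mem_minimalPrimes (isHomogeneous_span_range hf) hp) hpm
        (fun i => (hpp.radical_le_iff.mpr hp.1.2) (hlf i i.2)) with h | h
      · exact Ideal.mul_le_left.trans h
      · exact Ideal.mul_le_right.trans h
  obtain ⟨e, rfl⟩ : ∃ e, D = r + (e + 2) := ⟨D - r - 2, by omega⟩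
  obtain ⟨F, δ, hδ, hF, hFf, hrad⟩ := exists_parameters h𝒜 hf (e := e + 2) (by simpa using hht)
    (by rw [hD, Fintype.card_fin])
  let := (aeval (R := k) F).toAlgebra
  have hX : ∀ j, algebraMap (MvPolynomial (Fin r ⊕ Fin (e + 2)) k) A (X j) = F j :=
    fun j => aeval_X (R := k) F j
  have : IsScalarTower k (MvPolynomial (Fin r ⊕ Fin (e + 2)) k) A :=
    IsScalarTower.of_algHom (aeval (R := k) F)
  obtain ⟨G, hG⟩ := exists_finset_graded_le_span (κ := Fin r ⊕ Fin (e + 2)) h𝒜.fg h𝒜.mem_pow hδ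
    (by simpa only [hX] using hF) (by simpa only [hX] using hrad)
  have := finite_of_graded_le_span hG
  have := isPrime_irrelevantIdeal 𝒜
  have hinj := algebraMap_injective_of_card_le_height (k := k) (κ := Fin r ⊕ Fin (e + 2))
    (irrelevantIdeal 𝒜) (by rw [hD]; simp)
  have : FaithfulSMul (MvPolynomial (Fin r ⊕ Fin (e + 2)) k) A :=
    (faithfulSMul_iff_algebraMap_injective _ _).mpr hinj
  let S : Finset (Fin r ⊕ Fin (e + 2)) := Finset.univ.map Function.Embedding.inl
  let 𝔞 : Ideal A := (Ideal.span ((X : _ → MvPolynomial (Fin r ⊕ Fin (e + 2)) k) '' S)).map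
    (algebraMap _ A)
  have h𝔞 : ∀ q : Ideal A, Ideal.span (Set.range f) ≤ q → 𝔞 ≤ q := by
    intro q hq
    rw [Ideal.map_le_iff_le_comap, Ideal.span_le]
    rintro _ ⟨j, hj, rfl⟩
    obtain ⟨i, -, rfl⟩ := Finset.mem_map.mp hj
    obtain ⟨n, hn, hFn⟩ := hFf i
    rw [SetLike.mem_coe, Ideal.mem_comap, hX, Function.Embedding.inl_apply, hFn]
    exact q.pow_mem_of_mem (hq (Ideal.subset_span ⟨i, rfl⟩)) n hn
  have hf𝔞 : (Ideal.span (Set.range f)).radical ≤ 𝔞.radical := by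
    refine Ideal.radical_le_radical_iff.mpr (Ideal.span_le.mpr ?_)
    rintro _ ⟨i, rfl⟩
    obtain ⟨n, hn, hFn⟩ := hFf i
    refine ⟨n, ?_⟩
    rw [← hFn, ← hX]
    exact Ideal.mem_map_of_mem _ (Ideal.subset_span ⟨_, by simp [S], rfl⟩)
  obtain ⟨M, hM⟩ := Ideal.exists_pow_le_of_le_radical_of_fg (hIJ.trans hf𝔞)
    (IsNoetherian.noetherian _)
  rw [mul_pow] at hM
  have hdisj' : ∀ q : Ideal A, q.IsPrime → q.IsHomogeneous 𝒜 → I ^ M ≤ q → J ^ M ≤ q →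
      irrelevantIdeal 𝒜 ≤ q := fun q hq hqh h₁ h₂ =>
    hdisj q hq hqh (hq.le_of_pow_le h₁) (hq.le_of_pow_le h₂)
  have hpow := fun u => exists_pow_eq_add (isHomogeneous_pow hI M) (isHomogeneous_pow hJ M) hdisj'
    hδ (hF u)
  choose N i j hi hj hid hij using hpow (.inr 0)
  choose N' i' j' hi' hj' _ hij' using hpow (.inr 1)
  refine false_of_separated (k := k) (S := S) (u := .inr 0) (v := .inr 1) (by simp) (by simp [S])
    (by simp [S]) hM hi hj hi' hj' (N := N) (N' := N') ?_ ?_ ?_ (p := q₁) (q := q₂) (h𝔞 q₁ hfq₁)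
    (h𝔞 q₂ hfq₂) ?_ ?_
  · exact fun K => by rw [map_pow, hX, hij]
  · exact fun K => by rw [map_pow, hX, hij']
  · intro φ a
    obtain ⟨C, hC⟩ := exists_totalDegree_le_of_graded_le_span hδ hG φ a
    exact ⟨C, fun K => hC _ _ (hid K)⟩
  · exact fun h => hq₁m (hdisj q₁ hq₁ hq₁h (hIp₁.trans hpq₁) (hq₁.le_of_pow_le h))
  · exact fun h => hq₂m (hdisj q₂ hq₂ hq₂h (hq₂.le_of_pow_le h) (hJp₂.trans hpq₂))

/-- Fewer than `D` linear forms on a graded domain of dimension `D` have a common zero. -/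
theorem exists_isPrime_mem_of_lt_height [IsNoetherianRing A] [IsDomain A]
    {r : ℕ} (hr : (r : ℕ∞) < (irrelevantIdeal 𝒜).height) {l : Fin r → A}
    (hl : ∀ i, l i ∈ 𝒜 1) :
    ∃ p : Ideal A, p.IsPrime ∧ p.IsHomogeneous 𝒜 ∧ ¬ irrelevantIdeal 𝒜 ≤ p ∧ ∀ i, l i ∈ p := by
  have hle : Ideal.span (Set.range l) ≤ irrelevantIdeal 𝒜 := by
    rw [Ideal.span_le]
    rintro _ ⟨i, rfl⟩
    exact mem_irrelevantIdeal_of_mem 𝒜 one_pos (hl i)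
  have := isPrime_irrelevantIdeal 𝒜
  have hspan := isHomogeneous_span_range (𝒜 := 𝒜) (fun i => ⟨1, one_pos, hl i⟩)
  obtain ⟨p, hp, -⟩ := Ideal.exists_minimalPrimes_le hle
  have hpp := hp.1.1
  refine ⟨p, hpp, isHomogeneous_of_mem_minimalPrimes hspan hp, fun h => ?_,
    fun i => hp.1.2 (Ideal.subset_span ⟨i, rfl⟩)⟩
  have h1 := Ideal.height_le_card_of_mem_minimalPrimes_span (Set.finite_range l) hp
  have h2 : (Set.range l).ncard ≤ r := by
    rw [← Set.image_univ]
    exact (Set.ncard_image_le Set.finite_univ).trans (by simp [Set.ncard_univ])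
  exact absurd ((Ideal.height_mono h).trans (h1.trans (by exact_mod_cast h2))) (not_le.mpr hr)

end Connectedness

section QuotientGrading

variable {k B : Type*} [Field k] [CommRing B] [Algebra k B] (ℬ : ℕ → Submodule k B) (P : Ideal B)

/-- The images of the homogeneous components in a quotient algebra. -/
def quotientGrading (i : ℕ) : Submodule k (B ⧸ P) :=
  (ℬ i).map (Ideal.Quotient.mkₐ k P).toLinearMap

variable {ℬ P}

lemma mk_mem_quotientGrading {i : ℕ} {b : B} (hb : b ∈ ℬ i) :
    Ideal.Quotient.mk P b ∈ quotientGrading ℬ P i :=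
  ⟨b, hb, rfl⟩

variable [GradedAlgebra ℬ]

lemma isInternal_quotientGrading (hP : P.IsHomogeneous ℬ) :
    DirectSum.IsInternal (quotientGrading ℬ P) := by
  classical
  refine ⟨?_, ?_⟩
  · rw [injective_iff_map_eq_zero]
    intro x hx
    choose b hb hbx using fun i => (x i).2
    have hsum : ∑ i ∈ x.support, b i ∈ P := by
      rw [← Ideal.Quotient.eq_zero_iff_mem, map_sum, ← hx, DirectSum.coeAddMonoidHom_eq_dfinsuppSum]
      exact Finset.sum_congr rfl fun i _ => hbx i
    ext i
    by_cases hi : i ∈ x.support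
    · have h1 := hP i hsum
      rw [DirectSum.decompose_sum, DFinsupp.finsetSum_apply, AddSubmonoidClass.coe_finsetSum,
        Finset.sum_eq_single i (fun j _ hji => DirectSum.decompose_of_mem_ne ℬ (hb j) hji)
          (fun h => absurd hi h), DirectSum.decompose_of_mem_same ℬ (hb i)] at h1
      rw [← hbx i]
      exact Ideal.Quotient.eq_zero_iff_mem.mpr h1
    · simp [DFinsupp.notMem_support_iff.mp hi]
  · intro a
    obtain ⟨b, rfl⟩ := Ideal.Quotient.mk_surjective a
    refine ⟨∑ i ∈ (DirectSum.decompose ℬ b).support, DirectSum.of (fun i => quotientGrading ℬ P i) i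
      ⟨_, mk_mem_quotientGrading (DirectSum.decompose ℬ b i).2⟩, ?_⟩
    rw [map_sum]
    simp only [DirectSum.coeAddMonoidHom_of]
    rw [← map_sum, DirectSum.sum_support_decompose]

/-- The grading of the quotient of a graded algebra by a homogeneous ideal. -/
@[reducible]
def quotientGradedAlgebra (hP : P.IsHomogeneous ℬ) : GradedAlgebra (quotientGrading ℬ P) where
  one_mem := ⟨1, SetLike.GradedOne.one_mem, rfl⟩
  mul_mem := by
    rintro i j _ _ ⟨a, ha, rfl⟩ ⟨b, hb, rfl⟩
    exact ⟨a * b, SetLike.GradedMul.mul_mem ha hb, map_mul (Ideal.Quotient.mkₐ k P) a b⟩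
  __ := (isInternal_quotientGrading hP).chooseDecomposition

lemma decompose_mk [GradedAlgebra (quotientGrading ℬ P)] (b : B) (i : ℕ) :
    (DirectSum.decompose (quotientGrading ℬ P) (Ideal.Quotient.mk P b) i : B ⧸ P) =
      Ideal.Quotient.mk P (DirectSum.decompose ℬ b i) := by
  classical
  conv_lhs => rw [← DirectSum.sum_support_decompose ℬ b]
  rw [map_sum, DirectSum.decompose_sum, DFinsupp.finsetSum_apply, AddSubmonoidClass.coe_finsetSum]
  by_cases hi : i ∈ (DirectSum.decompose ℬ b).support
  · rw [Finset.sum_eq_single i (fun j _ hji => DirectSum.decompose_of_mem_ne _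
        (mk_mem_quotientGrading (SetLike.coe_mem _)) hji) (fun h => absurd hi h),
      DirectSum.decompose_of_mem_same _ (mk_mem_quotientGrading (SetLike.coe_mem _))]
  · rw [Finset.sum_eq_zero fun j hj => DirectSum.decompose_of_mem_ne _
        (mk_mem_quotientGrading (SetLike.coe_mem _)) (ne_of_mem_of_not_mem hj hi),
      DFinsupp.notMem_support_iff.mp hi]
    simp

lemma isHomogeneous_comap_mk [GradedAlgebra (quotientGrading ℬ P)]
    {q : Ideal (B ⧸ P)} (hq : q.IsHomogeneous (quotientGrading ℬ P)) :
    (q.comap (Ideal.Quotient.mk P)).IsHomogeneous ℬ := by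
  intro i b hb
  rw [Ideal.mem_comap, ← decompose_mk]
  exact hq i hb

lemma isHomogeneous_map_mk [GradedAlgebra (quotientGrading ℬ P)]
    {q : Ideal B} (hq : q.IsHomogeneous ℬ) :
    (q.map (Ideal.Quotient.mk P)).IsHomogeneous (quotientGrading ℬ P) := by
  intro i a ha
  obtain ⟨b, hb, rfl⟩ := (Ideal.mem_map_iff_of_surjective _ Ideal.Quotient.mk_surjective).mp ha
  rw [decompose_mk]
  exact Ideal.mem_map_of_mem _ (hq i hb)

lemma map_irrelevantIdeal [GradedAlgebra (quotientGrading ℬ P)] :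
    (irrelevantIdeal ℬ).map (Ideal.Quotient.mk P) ≤ irrelevantIdeal (quotientGrading ℬ P) := by
  rw [Ideal.map_le_iff_le_comap]
  intro b hb
  rw [mem_irrelevantIdeal_iff] at hb
  rw [Ideal.mem_comap, mem_irrelevantIdeal_iff, decompose_mk, hb, map_zero]

lemma comap_irrelevantIdeal_le_iff [GradedAlgebra (quotientGrading ℬ P)]
    {q : Ideal (B ⧸ P)} :
    irrelevantIdeal ℬ ≤ q.comap (Ideal.Quotient.mk P) ↔
      irrelevantIdeal (quotientGrading ℬ P) ≤ q := by
  refine ⟨fun h a ha => ?_, fun h => Ideal.map_le_iff_le_comap.mp (map_irrelevantIdeal.trans h)⟩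
  obtain ⟨b, rfl⟩ := Ideal.Quotient.mk_surjective a
  rw [mem_irrelevantIdeal_iff, decompose_mk, Ideal.Quotient.eq_zero_iff_mem] at ha
  have h1 : b - DirectSum.decompose ℬ b 0 ∈ irrelevantIdeal ℬ := by
    rw [mem_irrelevantIdeal_iff, DirectSum.decompose_sub, DFinsupp.sub_apply,
      AddSubgroupClass.coe_sub, DirectSum.decompose_of_mem_same _ (SetLike.coe_mem _), sub_self]
  have h2 := h h1
  rwa [Ideal.mem_comap, map_sub, Ideal.Quotient.eq_zero_iff_mem.mpr ha, sub_zero] at h2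

lemma isStandardGraded_quotientGrading [GradedAlgebra (quotientGrading ℬ P)]
    (hℬ : IsStandardGraded ℬ) :
    IsStandardGraded (quotientGrading ℬ P) where
  exists_algebraMap_eq := by
    rintro _ ⟨b, hb, rfl⟩
    obtain ⟨c, rfl⟩ := hℬ.exists_algebraMap_eq b hb
    exact ⟨c, rfl⟩
  fg e := (hℬ.fg e).map _
  mem_pow := by
    rintro e _ ⟨b, hb, rfl⟩
    refine Ideal.pow_right_mono map_irrelevantIdeal e ?_
    rw [← Ideal.map_pow]
    exact Ideal.mem_map_of_mem _ (hℬ.mem_pow e b hb)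

end QuotientGrading

section PolynomialGrading

variable {k : Type*} [Field k] {ι : Type*}

lemma isStandardGraded_homogeneousSubmodule [Finite ι] :
    IsStandardGraded (homogeneousSubmodule ι k) where
  exists_algebraMap_eq x hx := by
    rw [mem_homogeneousSubmodule, ← totalDegree_zero_iff_isHomogeneous,
      totalDegree_eq_zero_iff_eq_C] at hx
    exact ⟨_, hx.symm⟩
  fg e := homogeneousSubmodule_fg _ _ e
  mem_pow e a ha := by
    rw [← a.support_sum_monomial_coeff]
    refine Ideal.sum_mem _ fun s hs => ?_
    rw [monomial_eq]
    refine Ideal.mul_mem_left _ _ ?_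
    rw [← ha (mem_support_iff.mp hs), Finsupp.weight_apply, Finsupp.sum,
      ← Finset.prod_pow_eq_pow_sum]
    refine Ideal.prod_mem_prod fun i _ => ?_
    rw [smul_eq_mul, Pi.one_apply, mul_one]
    exact Ideal.pow_mem_pow (mem_irrelevantIdeal_of_mem _ one_pos (isHomogeneous_X k i)) _

end PolynomialGrading

section ProjectiveSpectrum

variable {k B : Type*} [Field k] [CommRing B] [Algebra k B] {ℬ : ℕ → Submodule k B}
  [GradedAlgebra ℬ]

lemma isPrime_vanishingIdeal {Z : Set (ProjectiveSpectrum ℬ)} (hZ : IsIrreducible Z) :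
    (ProjectiveSpectrum.vanishingIdeal Z).toIdeal.IsPrime := by
  refine Ideal.isPrime_iff.mpr ⟨?_, fun {f g} hfg => ?_⟩
  · obtain ⟨x, hx⟩ := hZ.nonempty
    rw [Ideal.ne_top_iff_one]
    exact fun h => x.isPrime.one_notMem ((ProjectiveSpectrum.mem_vanishingIdeal Z 1).mp h x hx)
  · simp only [HomogeneousIdeal.mem_iff, ProjectiveSpectrum.mem_vanishingIdeal] at hfg ⊢
    have h := (isPreirreducible_iff_isClosed_union_isClosed.mp hZ.isPreirreducible)
      (ProjectiveSpectrum.zeroLocus ℬ {f}) (ProjectiveSpectrum.zeroLocus ℬ {g})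
      (ProjectiveSpectrum.isClosed_zeroLocus ℬ _) (ProjectiveSpectrum.isClosed_zeroLocus ℬ _)
      fun x hx => by
        simpa using! x.isPrime.mem_or_mem (hfg x hx)
    refine h.imp (fun h x hx => ?_) (fun h x hx => ?_) <;> simpa using h hx

lemma mem_of_vanishingIdeal_le {Z : Set (ProjectiveSpectrum ℬ)} (hZ : IsClosed Z)
    {x : ProjectiveSpectrum ℬ}
    (h : (ProjectiveSpectrum.vanishingIdeal Z).toIdeal ≤ x.asHomogeneousIdeal.toIdeal) : x ∈ Z := by
  rw [← hZ.closure_eq, ← ProjectiveSpectrum.zeroLocus_vanishingIdeal_eq_closure]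
  exact h

lemma vanishingIdeal_le {Z : Set (ProjectiveSpectrum ℬ)} {x : ProjectiveSpectrum ℬ} (hx : x ∈ Z) :
    (ProjectiveSpectrum.vanishingIdeal Z).toIdeal ≤ x.asHomogeneousIdeal.toIdeal :=
  fun f hf => (ProjectiveSpectrum.mem_vanishingIdeal Z f).mp hf x hx

lemma vanishingIdeal_lt {Z W : Set (ProjectiveSpectrum ℬ)} (hZ : IsClosed Z) (h : Z ⊂ W) :
    (ProjectiveSpectrum.vanishingIdeal W).toIdeal <
      (ProjectiveSpectrum.vanishingIdeal Z).toIdeal := by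
  refine lt_of_le_not_ge (ProjectiveSpectrum.vanishingIdeal_anti_mono _ h.subset) fun h' => h.2 ?_
  exact fun x hx => mem_of_vanishingIdeal_le hZ (h'.trans (vanishingIdeal_le hx))

lemma coe_add_one_le_height_irrelevantIdeal (hℬ : IsStandardGraded ℬ)
    {C : Set (ProjectiveSpectrum ℬ)}
    (hC : IsClosed C) {P : Ideal B} (hP : P = (ProjectiveSpectrum.vanishingIdeal C).toIdeal)
    [P.IsPrime] [GradedAlgebra (quotientGrading ℬ P)] {d : ℕ}
    (hd : (d : WithBot ℕ∞) ≤ topologicalKrullDim C) :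
    ((d + 1 : ℕ) : ℕ∞) ≤ (irrelevantIdeal (quotientGrading ℬ P)).height := by
  obtain ⟨p, hp⟩ := Order.le_krullDim_iff.mp hd
  let W (i : Fin (p.length + 1)) : Set (ProjectiveSpectrum ℬ) := Subtype.val '' (p i : Set C)
  have hWc (i) : IsClosed (W i) := hC.isClosedEmbedding_subtypeVal.isClosedMap _ (p i).isClosed
  have hWi (i) : IsIrreducible (W i) :=
    (p i).isIrreducible.image _ continuous_subtype_val.continuousOn
  let Q (i : Fin (p.length + 1)) : Ideal (B ⧸ P) :=
    (ProjectiveSpectrum.vanishingIdeal (W i)).toIdeal.map (Ideal.Quotient.mk P)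
  have hPW (i) : P ≤ (ProjectiveSpectrum.vanishingIdeal (W i)).toIdeal := by
    rw [hP]
    exact ProjectiveSpectrum.vanishingIdeal_anti_mono _ (Subtype.coe_image_subset _ _)
  have hcomap (i) : (Q i).comap (Ideal.Quotient.mk P) =
      (ProjectiveSpectrum.vanishingIdeal (W i)).toIdeal := by
    rw [Ideal.comap_map_of_surjective _ Ideal.Quotient.mk_surjective, ← RingHom.ker_eq_comap_bot,
      Ideal.mk_ker, sup_eq_left.mpr (hPW i)]
  have hQp (i) : (Q i).IsPrime := by
    have := isPrime_vanishingIdeal (hWi i)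
    exact Ideal.map_isPrime_of_surjective Ideal.Quotient.mk_surjective (by simpa using hPW i)
  have hQlt {i j} (hij : i < j) : Q j < Q i := by
    have h1 : W i ⊂ W j := Subtype.val_injective.image_strictMono
      (SetLike.coe_ssubset_coe.mpr (p.strictMono hij))
    have h2 := vanishingIdeal_lt (hWc i) h1
    rw [← hcomap i, ← hcomap j] at h2
    exact lt_of_le_not_ge
      ((Ideal.comap_le_comap_iff_of_surjective _ Ideal.Quotient.mk_surjective _ _).mp h2.le)
      fun h => h2.not_ge (Ideal.comap_mono h)
  have hheight : ∀ i : ℕ, ∀ hi : i ≤ p.length,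
      (i : ℕ∞) ≤ (Q ⟨p.length - i, by omega⟩).height := by
    intro i
    induction i with
    | zero => simp
    | succ i ih =>
      intro hi
      rw [Nat.cast_succ]
      refine (add_le_add_left (ih (by omega)) 1).trans
        (Ideal.height_add_one_le_of_lt_of_isPrime (hQlt ?_))
      rw [Fin.mk_lt_mk]
      omega
  have hh := hheight p.length le_rfl
  set Q₀ := Q ⟨p.length - p.length, by omega⟩
  have : (irrelevantIdeal (quotientGrading ℬ P)).IsPrime := isPrime_irrelevantIdeal _
  have hQ₀ : Q₀ < irrelevantIdeal (quotientGrading ℬ P) := by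
    refine lt_of_le_not_ge (le_irrelevantIdeal
      (isStandardGraded_quotientGrading hℬ).exists_algebraMap_eq
      (isHomogeneous_map_mk (HomogeneousIdeal.isHomogeneous _)) (hQp _).ne_top) fun h => ?_
    rw [← comap_irrelevantIdeal_le_iff, hcomap] at h
    obtain ⟨x, hx⟩ := (hWi ⟨p.length - p.length, by omega⟩).nonempty
    exact x.not_irrelevant_le (h.trans (vanishingIdeal_le hx))
  rw [← hp, Nat.cast_succ]
  exact (add_le_add_left hh 1).trans (Ideal.height_add_one_le_of_lt_of_isPrime hQ₀)

/-- A closed irreducible subset of dimension `d` of the projective spectrum of a standard graded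
algebra meets `r < d` hyperplanes in a connected set. -/
theorem isConnected_inter_hyperplanes [IsNoetherianRing B] (hℬ : IsStandardGraded ℬ)
    {C : Set (ProjectiveSpectrum ℬ)} (hC : IsClosed C) (hCirr : IsIrreducible C) {d r : ℕ}
    (hd : (d : WithBot ℕ∞) ≤ topologicalKrullDim C) (hrd : r < d) {σ : Fin r → B}
    (hσ : ∀ i, σ i ∈ ℬ 1) :
    IsConnected (C ∩ ProjectiveSpectrum.zeroLocus ℬ (Set.range σ)) := by
  obtain ⟨P, hP⟩ : ∃ P, P = (ProjectiveSpectrum.vanishingIdeal C).toIdeal := ⟨_, rfl⟩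
  have hPh : P.IsHomogeneous ℬ := hP ▸ HomogeneousIdeal.isHomogeneous _
  have hPp : P.IsPrime := hP ▸ isPrime_vanishingIdeal hCirr
  let := quotientGradedAlgebra hPh
  have h𝒜 := isStandardGraded_quotientGrading (P := P) hℬ
  have hht := coe_add_one_le_height_irrelevantIdeal hℬ hC hP hd
  have hmp : (irrelevantIdeal (quotientGrading ℬ P)).IsPrime := isPrime_irrelevantIdeal _
  obtain ⟨D, hD⟩ := ENat.ne_top_iff_exists.mp
    (Ideal.height_ne_top (I := irrelevantIdeal (quotientGrading ℬ P)) hmp.ne_top)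
  rw [← hD, Nat.cast_le] at hht
  let l : Fin r → B ⧸ P := fun i => Ideal.Quotient.mk P (σ i)
  have hl : ∀ i, l i ∈ quotientGrading ℬ P 1 := fun i => mk_mem_quotientGrading (hσ i)
  let pt (q : Ideal (B ⧸ P)) (hq : q.IsPrime) (hqh : q.IsHomogeneous (quotientGrading ℬ P))
      (hqm : ¬ irrelevantIdeal (quotientGrading ℬ P) ≤ q) : ProjectiveSpectrum ℬ :=
    ⟨⟨q.comap (Ideal.Quotient.mk P), isHomogeneous_comap_mk hqh⟩, hq.comap _,
      fun h => hqm (comap_irrelevantIdeal_le_iff.mp h)⟩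
  have hpt (q hq hqh hqm) (hlq : ∀ i, l i ∈ q) :
      pt q hq hqh hqm ∈ C ∩ ProjectiveSpectrum.zeroLocus ℬ (Set.range σ) := by
    refine ⟨mem_of_vanishingIdeal_le hC ?_, ?_⟩
    · rw [← hP]
      exact (Ideal.mk_ker (I := P)).ge.trans (Ideal.ker_le_comap _)
    · rintro _ ⟨i, rfl⟩
      exact hlq i
  refine ⟨?_, ?_⟩
  · obtain ⟨q, hq, hqh, hqm, hlq⟩ := exists_isPrime_mem_of_lt_height (r := r) (l := l)
      (by rw [← hD]; exact_mod_cast (by omega : r < D)) hl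
    exact ⟨_, hpt q hq hqh hqm hlq⟩
  set Y := C ∩ ProjectiveSpectrum.zeroLocus ℬ (Set.range σ) with hY
  have hYc : IsClosed Y := hC.inter (ProjectiveSpectrum.isClosed_zeroLocus _ _)
  rw [isPreconnected_closed_iff]
  intro E₁ E₂ hE₁ hE₂ hE ⟨x₁, hx₁⟩ ⟨x₂, hx₂⟩
  by_contra hne
  let I (E : Set (ProjectiveSpectrum ℬ)) : Ideal (B ⧸ P) :=
    (ProjectiveSpectrum.vanishingIdeal (Y ∩ E)).toIdeal.map (Ideal.Quotient.mk P)
  have hIh (E) : (I E).IsHomogeneous (quotientGrading ℬ P) :=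
    isHomogeneous_map_mk (HomogeneousIdeal.isHomogeneous _)
  have hlI (E) (i : Fin r) : l i ∈ I E := Ideal.mem_map_of_mem _
    ((ProjectiveSpectrum.mem_vanishingIdeal _ _).mpr fun x hx => hx.1.2 ⟨i, rfl⟩)
  have hmem {E} (hEc : IsClosed E) {q hq hqh hqm} (hIq : I E ≤ q) : pt q hq hqh hqm ∈ Y ∩ E :=
    mem_of_vanishingIdeal_le (hYc.inter hEc) (Ideal.map_le_iff_le_comap.mp hIq)
  have hle {E q hq hqh hqm} (h : pt q hq hqh hqm ∈ Y ∩ E) : I E ≤ q :=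
    Ideal.map_le_iff_le_comap.mpr (vanishingIdeal_le h)
  have hex {E} {x : ProjectiveSpectrum ℬ} (hx : x ∈ Y ∩ E) : ∃ p : Ideal (B ⧸ P), p.IsPrime ∧
      p.IsHomogeneous (quotientGrading ℬ P) ∧ ¬ irrelevantIdeal (quotientGrading ℬ P) ≤ p ∧
      I E ≤ p := by
    have hPx : P ≤ x.asHomogeneousIdeal.toIdeal := hP ▸ vanishingIdeal_le hx.1.1
    refine ⟨x.asHomogeneousIdeal.toIdeal.map (Ideal.Quotient.mk P),
      Ideal.map_isPrime_of_surjective Ideal.Quotient.mk_surjective (by simpa using hPx),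
      isHomogeneous_map_mk (HomogeneousIdeal.isHomogeneous _), ?_,
      Ideal.map_mono (vanishingIdeal_le hx)⟩
    rw [← comap_irrelevantIdeal_le_iff,
      Ideal.comap_map_of_surjective _ Ideal.Quotient.mk_surjective, ← RingHom.ker_eq_comap_bot,
      Ideal.mk_ker, sup_eq_left.mpr hPx]
    exact x.not_irrelevant_le
  obtain ⟨p₁, hp₁, hp₁h, hp₁m, hIp₁⟩ := hex hx₁
  obtain ⟨p₂, hp₂, hp₂h, hp₂m, hIp₂⟩ := hex hx₂
  refine false_of_disconnected h𝒜 hD.symm (by omega) hl (hIh E₁) (hIh E₂) (hlI E₁) (hlI E₂)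
    (fun q hq hqh hqm hlq => ?_) (fun q hq hqh h₁ h₂ => ?_) hp₁ hp₂ hp₁h hp₂h hp₁m hp₂m hIp₁ hIp₂
  · have h := hpt q hq hqh hqm hlq
    exact (hE h).imp (fun h' => hle (hq := hq) (hqh := hqh) (hqm := hqm) ⟨h, h'⟩)
      (fun h' => hle (hq := hq) (hqh := hqh) (hqm := hqm) ⟨h, h'⟩)
  · by_contra hqm
    have h₁' := hmem (hq := hq) (hqh := hqh) (hqm := hqm) hE₁ h₁
    exact hne ⟨_, h₁'.1, h₁'.2, (hmem (hq := hq) (hqh := hqh) (hqm := hqm) hE₂ h₂).2⟩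

end ProjectiveSpectrum

/-- **Grothendieck's connectedness theorem.**  Let `k` be an algebraically closed field
and let `C ⊆ ℙⁿ_k` be a closed irreducible subvariety of dimension `d ≥ 2`.  Let
`σ 0, …, σ (r-1)` be nonzero linear forms, defining hyperplanes `H_i ⊆ ℙⁿ`, with
`1 ≤ r ≤ d - 1`.  Then the set-theoretic intersection `C ∩ H₁ ∩ ⋯ ∩ H_r` is nonempty
and connected. -/
theorem grothendieck_hyperplane_connectedness
    (k : Type) [Field k] [IsAlgClosed k]
    (n d r : ℕ)
    (C : Set (ProjSpace k n)) (hCcl : IsClosed C) (hCirr : IsIrreducible C)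
    (hdim : topologicalKrullDim C = ((d : ℕ) : WithBot ℕ∞)) (hd : 2 ≤ d)
    (hr1 : 1 ≤ r) (hrd : r ≤ d - 1)
    (σ : Fin r → MvPolynomial (Fin (n + 1)) k)
    (hσ : ∀ i, (σ i).IsHomogeneous 1) (hσ0 : ∀ i, σ i ≠ 0) :
    IsConnected (C ∩ ⋂ i : Fin r, {x : ProjSpace k n | σ i ∈ x.asHomogeneousIdeal}) := by
  have h : (⋂ i : Fin r, {x : ProjSpace k n | σ i ∈ x.asHomogeneousIdeal}) =
      ProjectiveSpectrum.zeroLocus (homogeneousSubmodule (Fin (n + 1)) k) (Set.range σ) := by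
    ext x
    exact Set.mem_iInter.trans Set.range_subset_iff.symm
  rw [h]
  exact isConnected_inter_hyperplanes isStandardGraded_homogeneousSubmodule (C := C) hCcl hCirr
    hdim.ge (by omega) hσ

end
end
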